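/- arXiv:math/0109055 — 6 statements merged into one kernel-verified Lean document; each statement's English description precedes it below -/
import Mathlib

section
/- Let a : ℝ² → ℂ be smooth on R = (−a₀,a₀)×(−b₀,b₀) and L = ∂/∂y + a(x,y)∂/∂x be locally integrable at the origin. Let g solve g′(y) = Re a(g(y), y), g(0) = 0 on [0, η₀), and assume that for some η ∈ (0, η₀) one has Im a(g(y), y) = 0 for all y ∈ (0, η) (i.e., no sequence of elliptic points of L on the integral curve of X = Re L through the origin converges to the origin from the region y > 0). Then there exist δ > 0 and a bounded function u : (−δ,δ)×[0,δ) → ℂ which is C^∞ up to the boundary y = 0, satisfies Lu = 0 on (−δ,δ)×(0,δ), satisfies ∫_{−δ}^{δ} ln|u(x,0)| dx = −∞, and does not vanish identically on the intersection of (−δ,δ)×(0,δ) with any neighborhood of the origin. -/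
open MeasureTheory Set Filter Topology Complex

/-- Partial derivative in the `x` direction. -/
noncomputable def pdx (f : ℝ × ℝ → ℂ) (p : ℝ × ℝ) : ℂ := fderiv ℝ f p (1, 0)

/-- Partial derivative in the `y` direction. -/
noncomputable def pdy (f : ℝ × ℝ → ℂ) (p : ℝ × ℝ) : ℂ := fderiv ℝ f p (0, 1)

/-- `L = ∂/∂y + a ∂/∂x` is locally integrable at the origin: there is a smooth
first integral `Z` near `(0,0)` with `LZ = 0` and `dZ(0,0) ≠ 0`. -/
def LocallyIntegrableAtOrigin (a : ℝ × ℝ → ℂ) : Prop :=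
  ∃ U : Set (ℝ × ℝ), IsOpen U ∧ (0, 0) ∈ U ∧ ∃ Z : ℝ × ℝ → ℂ,
    ContDiffOn ℝ (⊤ : ℕ∞) Z U ∧ (∀ p ∈ U, pdy Z p + a p * pdx Z p = 0) ∧
    fderiv ℝ Z (0, 0) ≠ 0

/-- `∫_s ln|f| dx = -∞`, with the convention `ln 0 = -∞`: either `f` vanishes on a
set of positive measure, or `max(-ln|f|, 0)` has infinite integral over `s`. -/
def LogIntegralNegInf (f : ℝ → ℂ) (s : Set ℝ) : Prop :=
  0 < volume {x ∈ s | f x = 0} ∨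
    ∫⁻ x in s, ENNReal.ofReal (max (-Real.log ‖f x‖) 0) = ⊤

/-- The closed double sector `|Im z| ≤ |Re z|`. -/
def doubleSector : Set ℂ := {z | |z.im| ≤ |z.re|}

/-- The function `P(1/z) exp(-1/z)` on the right half plane, extended by zero. -/
noncomputable def flatExp (P : Polynomial ℂ) (z : ℂ) : ℂ :=
  if 0 < z.re then P.eval z⁻¹ * exp (-z⁻¹) else 0

lemma flatExp_of_re_pos (P : Polynomial ℂ) {z : ℂ} (hz : 0 < z.re) :
    flatExp P z = P.eval z⁻¹ * exp (-z⁻¹) := if_pos hz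

lemma flatExp_of_re_nonpos (P : Polynomial ℂ) {z : ℂ} (hz : z.re ≤ 0) : flatExp P z = 0 :=
  if_neg hz.not_gt

lemma flatExp_add (P Q : Polynomial ℂ) (z : ℂ) :
    flatExp (P + Q) z = flatExp P z + flatExp Q z := by
  by_cases h : 0 < z.re <;> simp [flatExp, h, add_mul]

lemma flatExp_X_mul (P : Polynomial ℂ) (z : ℂ) :
    flatExp (Polynomial.X * P) z = z⁻¹ * flatExp P z := by
  by_cases h : 0 < z.re <;> simp [flatExp, h, mul_assoc]

lemma norm_flatExp_one_le (z : ℂ) : ‖flatExp 1 z‖ ≤ 1 := by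
  rcases lt_or_ge 0 z.re with h | h
  · rw [flatExp_of_re_pos _ h, Polynomial.eval_one, one_mul, norm_exp, Real.exp_le_one_iff,
      neg_re, neg_nonpos, inv_re]
    exact div_nonneg h.le (normSq_nonneg z)
  · simp [flatExp_of_re_nonpos _ h]

lemma half_norm_inv_le_re_inv {z : ℂ} (hz : z ∈ doubleSector) (hre : 0 < z.re) :
    1 / 2 * ‖z⁻¹‖ ≤ (z⁻¹).re := by
  have hz0 : z ≠ 0 := by rintro rfl; simp at hre
  have hpos : 0 < ‖z‖ := norm_pos_iff.2 hz0
  have h1 : ‖z‖ ≤ 2 * z.re := by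
    have h2 : |z.im| ≤ |z.re| := hz
    have h3 := norm_le_abs_re_add_abs_im z
    rw [abs_of_pos hre] at h2 h3
    linarith
  rw [inv_re, normSq_eq_norm_sq, norm_inv, le_div_iff₀ (by positivity)]
  field_simp
  exact h1

lemma tendsto_flatExp_zero (P : Polynomial ℂ) :
    Tendsto (flatExp P) (𝓝[doubleSector \ {0}] 0) (𝓝 0) := by
  induction P using Polynomial.induction_on' with
  | add P Q hP hQ =>
    simpa only [← flatExp_add, add_zero] using hP.add hQ
  | monomial n c =>
    have hr : Tendsto (fun z : ℂ => ‖z⁻¹‖) (𝓝[doubleSector \ {0}] 0) atTop :=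
      (tendsto_norm_inv_nhdsNE_zero_atTop).mono_left (nhdsWithin_mono _ fun z hz => hz.2)
    have hlim := ((tendsto_rpow_mul_exp_neg_mul_atTop_nhds_zero (n : ℝ) (1 / 2)
      (by norm_num)).comp hr).const_mul ‖c‖
    rw [mul_zero] at hlim
    refine squeeze_zero_norm' ?_ hlim
    filter_upwards [self_mem_nhdsWithin] with z hz
    rcases lt_or_ge 0 z.re with h | h
    · rw [flatExp_of_re_pos _ h, Polynomial.eval_monomial, norm_mul, norm_mul, norm_pow, norm_exp,
        mul_assoc, Function.comp_apply, Real.rpow_natCast, neg_re]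
      have := half_norm_inv_le_re_inv hz.1 h
      gcongr
      linarith
    · rw [flatExp_of_re_nonpos _ h, norm_zero, Function.comp_apply]
      positivity

/-- The polynomial `Q` such that `Q(1/z) exp(-1/z)` is the derivative of `P(1/z) exp(-1/z)`. -/
noncomputable def flatExpDeriv (P : Polynomial ℂ) : Polynomial ℂ :=
  Polynomial.X ^ 2 * (P - Polynomial.derivative P)

lemma hasDerivWithinAt_flatExp (P : Polynomial ℂ) {z : ℂ} (hz : z ∈ doubleSector) :
    HasDerivWithinAt (flatExp P) (flatExp (flatExpDeriv P) z) doubleSector z := by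
  rcases lt_trichotomy z.re 0 with h | h | h
  · rw [flatExp_of_re_nonpos _ h.le]
    refine ((hasDerivAt_const z (0 : ℂ)).congr_of_eventuallyEq ?_).hasDerivWithinAt
    filter_upwards [(isOpen_lt continuous_re continuous_const).mem_nhds h] with w hw
    exact flatExp_of_re_nonpos _ (le_of_lt hw)
  · have h0 : z = 0 := by
      have h2 : |z.im| ≤ |z.re| := hz
      rw [h, abs_zero, abs_nonpos_iff] at h2
      exact Complex.ext h h2
    subst h0
    rw [flatExp_of_re_nonpos _ h.le, hasDerivWithinAt_iff_tendsto_slope]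
    refine (tendsto_flatExp_zero (Polynomial.X * P)).congr fun w => ?_
    rw [flatExp_X_mul, slope_def_field, flatExp_of_re_nonpos P h.le, sub_zero, sub_zero,
      div_eq_inv_mul]
  · have hz0 : z ≠ 0 := by rintro rfl; simp at h
    have hinv : HasDerivAt (fun w : ℂ => w⁻¹) (-(z ^ 2)⁻¹) z := hasDerivAt_inv hz0
    have hprod := ((P.hasDerivAt z⁻¹).comp z hinv).mul hinv.neg.cexp
    have hval : flatExp (flatExpDeriv P) z =
        (Polynomial.derivative P).eval z⁻¹ * -(z ^ 2)⁻¹ * exp (-z⁻¹) +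
          P.eval z⁻¹ * (exp (-z⁻¹) * -(-(z ^ 2)⁻¹)) := by
      rw [flatExp_of_re_pos _ h, flatExpDeriv]
      simp only [Polynomial.eval_mul, Polynomial.eval_pow, Polynomial.eval_X, Polynomial.eval_sub]
      ring
    rw [hval]
    refine (hprod.congr_of_eventuallyEq ?_).hasDerivWithinAt
    filter_upwards [(isOpen_lt continuous_const continuous_re).mem_nhds h] with w hw
    exact flatExp_of_re_pos _ hw

lemma contDiffOn_flatExp (P : Polynomial ℂ) :
    ContDiffOn ℂ (⊤ : ℕ∞) (flatExp P) doubleSector := by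
  refine contDiffOn_infty.2 fun n => ?_
  induction n generalizing P with
  | zero => exact contDiffOn_zero.2 fun z hz => (hasDerivWithinAt_flatExp P hz).continuousWithinAt
  | succ n ih =>
    push_cast
    refine (contDiffOn_succ_iff_hasFDerivWithinAt (by simp)).2 fun z hz =>
      ⟨doubleSector, by rw [insert_eq_of_mem hz]; exact self_mem_nhdsWithin, by simp,
        fun w => ContinuousLinearMap.toSpanSingleton ℂ (flatExp (flatExpDeriv P) w),
        fun w hw => (hasDerivWithinAt_flatExp P hw).hasFDerivWithinAt, ?_⟩
    exact (ContinuousLinearMap.toSpanSingletonCLE (𝕜 := ℂ) (E := ℂ)).contDiff.comp_contDiffOn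
      (ih (flatExpDeriv P))

lemma mem_doubleSector_of_norm_sub_le {z : ℂ} {t : ℝ} (h : ‖z - t‖ ≤ 1 / 2 * |t|) :
    z ∈ doubleSector := by
  have hre := (abs_re_le_norm (z - t)).trans h
  have him := (abs_im_le_norm (z - t)).trans h
  simp only [sub_re, ofReal_re, sub_im, ofReal_im, sub_zero] at hre him
  have := abs_sub_abs_le_abs_sub t z.re
  rw [abs_sub_comm] at this
  change |z.im| ≤ |z.re|
  linarith

lemma re_pos_of_norm_sub_le {z : ℂ} {t : ℝ} (h : ‖z - t‖ ≤ 1 / 2 * |t|) (ht : 0 < t) :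
    0 < z.re := by
  have hre := (abs_re_le_norm (z - t)).trans h
  simp only [sub_re, ofReal_re, abs_of_pos ht, abs_le] at hre
  linarith [hre.1]

lemma re_neg_of_norm_sub_le {z : ℂ} {t : ℝ} (h : ‖z - t‖ ≤ 1 / 2 * |t|) (ht : t < 0) :
    z.re < 0 := by
  have hre := (abs_re_le_norm (z - t)).trans h
  simp only [sub_re, ofReal_re, abs_of_neg ht, abs_le] at hre
  linarith [hre.2]

lemma map_pair_eq (T : ℝ × ℝ →L[ℝ] ℂ) (s t : ℝ) : T (s, t) = s * T (1, 0) + t * T (0, 1) := by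
  have : ((s, t) : ℝ × ℝ) = s • (1, 0) + t • (0, 1) := by simp
  rw [this, map_add, map_smul, map_smul, real_smul, real_smul]

/-- A first integral can be normalized to vanish at the origin and have unit `x`-derivative
there. -/
lemma LocallyIntegrableAtOrigin.exists_normalized {a : ℝ × ℝ → ℂ}
    (h : LocallyIntegrableAtOrigin a) :
    ∃ U : Set (ℝ × ℝ), IsOpen U ∧ (0, 0) ∈ U ∧ ∃ Z : ℝ × ℝ → ℂ,
      ContDiffOn ℝ (⊤ : ℕ∞) Z U ∧ (∀ p ∈ U, pdy Z p + a p * pdx Z p = 0) ∧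
      Z (0, 0) = 0 ∧ pdx Z (0, 0) = 1 := by
  obtain ⟨U, hU, h0, Z, hZ, hL, hd⟩ := h
  have hx : pdx Z (0, 0) ≠ 0 := by
    intro hx
    have hy := hL _ h0
    rw [hx, mul_zero, add_zero] at hy
    refine hd (ContinuousLinearMap.ext fun v => ?_)
    rw [map_pair_eq, show fderiv ℝ Z (0, 0) (1, 0) = 0 from hx,
      show fderiv ℝ Z (0, 0) (0, 1) = 0 from hy]
    simp
  obtain ⟨c, hc⟩ : ∃ c, pdx Z (0, 0) = c := ⟨_, rfl⟩
  rw [hc] at hx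
  have hfd : ∀ p ∈ U, fderiv ℝ (fun p => c⁻¹ * (Z p - Z (0, 0))) p =
      c⁻¹ • fderiv ℝ Z p := fun p hp =>
    ((((hZ.contDiffAt (hU.mem_nhds hp)).differentiableAt (by simp)).hasFDerivAt.sub_const
      (Z (0, 0))).const_mul _).fderiv
  refine ⟨U, hU, h0, fun p => c⁻¹ * (Z p - Z (0, 0)),
    contDiffOn_const.mul (hZ.sub contDiffOn_const), fun p hp => ?_, by simp, ?_⟩
  · have := hL p hp
    rw [pdy, pdx, hfd p hp]
    rw [pdy, pdx] at this
    simp only [smul_apply, smul_eq_mul]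
    linear_combination c⁻¹ * this
  · rw [pdx, hfd _ h0]
    rw [smul_apply, ← pdx, hc]
    exact inv_mul_cancel₀ hx

/-- A first integral is constant along an integral curve of `Re L` free of elliptic points. -/
lemma firstIntegral_eq_on_curve {a Z : ℝ × ℝ → ℂ} {g : ℝ → ℝ} {b : ℝ}
    (hZ : ∀ y ∈ Ico 0 b, DifferentiableAt ℝ Z (g y, y))
    (hL : ∀ y ∈ Ico 0 b, pdy Z (g y, y) + a (g y, y) * pdx Z (g y, y) = 0)
    (hg : ∀ y ∈ Ico 0 b, HasDerivAt g (a (g y, y)).re y)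
    (him : ∀ y ∈ Ico 0 b, (a (g y, y)).im = 0) {y : ℝ} (hy : y ∈ Ico 0 b) :
    Z (g y, y) = Z (g 0, 0) := by
  have hd : ∀ t ∈ Ico 0 b, HasDerivAt (fun t => Z (g t, t)) 0 t := fun t ht => by
    have h1 := HasFDerivAt.comp_hasDerivAt (f := fun s => (g s, s)) t
      (hZ t ht).hasFDerivAt ((hg t ht).prodMk (hasDerivAt_id t))
    have h2 : fderiv ℝ Z (g t, t) ((a (g t, t)).re, 1) = 0 := by
      have h3 := hL t ht
      have h4 : a (g t, t) = ((a (g t, t)).re : ℂ) := Complex.ext (by simp) (by simp [him t ht])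
      rw [h4] at h3
      rw [map_pair_eq, ofReal_one, one_mul, add_comm]
      exact h3
    rw [h2] at h1
    exact h1
  exact constant_of_has_deriv_right_zero
    (fun t ht => (hd t ⟨ht.1, ht.2.trans_lt hy.2⟩).continuousAt.continuousWithinAt)
    (fun t ht => (hd t ⟨ht.1, ht.2.trans hy.2⟩).hasDerivWithinAt) y ⟨hy.1, le_rfl⟩

/-- Theorem 1.2 (second half): if the integral curve of `X = Re L` through the
origin contains no sequence of elliptic points converging to the origin from
`{y > 0}`, then strong uniqueness fails: there is a bounded smooth one-sided
solution whose boundary value has divergent logarithmic integral but which does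
not vanish identically near the origin. -/
theorem strong_uniqueness_fails
    (a₀ b₀ : ℝ) (ha₀ : 0 < a₀) (hb₀ : 0 < b₀)
    (a : ℝ × ℝ → ℂ) (ha : ContDiffOn ℝ (⊤ : ℕ∞) a (Ioo (-a₀) a₀ ×ˢ Ioo (-b₀) b₀))
    (hloc : LocallyIntegrableAtOrigin a)
    -- the integral curve of `X = Re L` through the origin
    (η₀ : ℝ) (hη₀ : 0 < η₀) (g : ℝ → ℝ) (hg0 : g 0 = 0)
    (hg : ∀ y ∈ Ico 0 η₀, (g y, y) ∈ Ioo (-a₀) a₀ ×ˢ Ioo (-b₀) b₀ ∧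
      HasDerivAt g (a (g y, y)).re y)
    -- no elliptic points on the curve near the origin with `y > 0`
    (η : ℝ) (hη : 0 < η) (hηη₀ : η < η₀)
    (hnonell : ∀ y ∈ Ioo 0 η, (a (g y, y)).im = 0) :
    ∃ δ : ℝ, 0 < δ ∧ ∃ u : ℝ × ℝ → ℂ,
      (∃ C : ℝ, ∀ p ∈ Ioo (-δ) δ ×ˢ Ico 0 δ, ‖u p‖ ≤ C) ∧
      ContDiffOn ℝ (⊤ : ℕ∞) u (Ioo (-δ) δ ×ˢ Ico 0 δ) ∧
      (∀ p ∈ Ioo (-δ) δ ×ˢ Ioo 0 δ, pdy u p + a p * pdx u p = 0) ∧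
      LogIntegralNegInf (fun x => u (x, 0)) (Ioo (-δ) δ) ∧
      ∀ V ∈ 𝓝 ((0, 0) : ℝ × ℝ), ∃ p ∈ (Ioo (-δ) δ ×ˢ Ioo 0 δ) ∩ V, u p ≠ 0 := by
  obtain ⟨U, hU, h0U, Z, hZ, hL, hZ0, hZx⟩ := hloc.exists_normalized
  have hgc : ContinuousAt g 0 := (hg 0 ⟨le_rfl, hη₀⟩).2.continuousAt
  have hcurve : Tendsto (fun y => (g y, y)) (𝓝 0) (𝓝 (0, 0)) := by
    have := hgc.prodMk continuousAt_id
    rwa [ContinuousAt, hg0] at this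
  have him : ∀ y ∈ Ico 0 η, (a (g y, y)).im = 0 := by
    intro y hy
    rcases hy.1.eq_or_lt with rfl | h
    · have hR : Ioo (-a₀) a₀ ×ˢ Ioo (-b₀) b₀ ∈ 𝓝 ((0, 0) : ℝ × ℝ) :=
        (isOpen_Ioo.prod isOpen_Ioo).mem_nhds (by simp [ha₀, hb₀])
      have hac := (continuous_im.continuousAt.comp (ha.continuousOn.continuousAt hR)).tendsto.comp
        (hcurve.mono_left (nhdsWithin_le_nhds (s := Ioi 0)))
      rw [hg0]
      refine tendsto_nhds_unique hac (tendsto_const_nhds.congr' ?_)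
      filter_upwards [Ioo_mem_nhdsGT hη] with t ht
      exact (hnonell t ht).symm
    · exact hnonell y ⟨h, hy.2⟩
  have hstrict := (hZ.contDiffAt (hU.mem_nhds h0U)).hasStrictFDerivAt (by simp)
  obtain ⟨W, hW, hWest⟩ : ∃ W ∈ 𝓝 ((0, 0) : ℝ × ℝ), ∀ p ∈ W, ∀ q ∈ W,
      ‖Z p - Z q - fderiv ℝ Z (0, 0) (p - q)‖ ≤ 1 / 2 * ‖p - q‖ := by
    have := hstrict.isLittleO.def (by norm_num : (0 : ℝ) < 1 / 2)
    rw [nhds_prod_eq] at this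
    obtain ⟨W, hW, h⟩ := mem_prod_self_iff.1 this
    exact ⟨W, hW, fun p hp q hq => h (mk_mem_prod hp hq)⟩
  obtain ⟨δ₁, hδ₁, hball⟩ := Metric.mem_nhds_iff.1 (inter_mem hW (hU.mem_nhds h0U))
  obtain ⟨δ₂, hδ₂, hball₂⟩ := Metric.mem_nhds_iff.1
    (hcurve (inter_mem hW (hU.mem_nhds h0U)))
  obtain ⟨δ, hδ, hδη, hδlt₁, hδlt₂⟩ : ∃ δ : ℝ, 0 < δ ∧ δ ≤ η ∧ δ ≤ δ₁ ∧ δ ≤ δ₂ :=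
    ⟨min η (min δ₁ δ₂), by positivity, by simp, by simp, by simp⟩
  have hcW : ∀ y ∈ Ico 0 δ, (g y, y) ∈ W ∩ U := fun y hy => hball₂ <| by
    rw [mem_ball_zero_iff, Real.norm_eq_abs, abs_of_nonneg hy.1]
    exact hy.2.trans_le hδlt₂
  have hbox : ∀ p ∈ Ioo (-δ) δ ×ˢ Ico 0 δ, p ∈ W ∩ U := fun p hp => hball <| by
    rw [← Prod.zero_eq_mk, mem_ball_zero_iff, Prod.norm_def, max_lt_iff, Real.norm_eq_abs,
      Real.norm_eq_abs, abs_lt, abs_of_nonneg hp.2.1]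
    exact ⟨⟨by linarith [hp.1.1], hp.1.2.trans_le hδlt₁⟩, hp.2.2.trans_le hδlt₁⟩
  have hZdiff : ∀ p ∈ U, DifferentiableAt ℝ Z p := fun p hp =>
    (hZ.contDiffAt (hU.mem_nhds hp)).differentiableAt (by simp)
  have hZcurve : ∀ y ∈ Ico 0 δ, Z (g y, y) = 0 := fun y hy => by
    rw [firstIntegral_eq_on_curve (fun t ht => hZdiff _ (hcW t ht).2)
      (fun t ht => hL _ (hcW t ht).2)
      (fun t ht => (hg t ⟨ht.1, ht.2.trans_le (hδη.trans hηη₀.le)⟩).2)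
      (fun t ht => him t ⟨ht.1, ht.2.trans_le hδη⟩) hy, hg0, hZ0]
  have hest : ∀ p ∈ Ioo (-δ) δ ×ˢ Ico 0 δ,
      ‖Z p - ((p.1 - g p.2 : ℝ) : ℂ)‖ ≤ 1 / 2 * |p.1 - g p.2| := by
    rintro ⟨x, y⟩ hp
    have h := hWest _ (hbox _ hp).1 _ (hcW y hp.2).1
    rw [hZcurve y hp.2, sub_zero, Prod.mk_sub_mk, sub_self, map_pair_eq,
      show fderiv ℝ Z (0, 0) (1, 0) = 1 from hZx] at h
    simpa [Prod.norm_def] using h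
  have hmaps : MapsTo Z (Ioo (-δ) δ ×ˢ Ico 0 δ) doubleSector := fun p hp =>
    mem_doubleSector_of_norm_sub_le (hest p hp)
  refine ⟨δ, hδ, flatExp 1 ∘ Z, ⟨1, fun p _ => norm_flatExp_one_le _⟩,
    ((contDiffOn_flatExp 1).restrict_scalars ℝ).comp (hZ.mono fun p hp => (hbox p hp).2) hmaps,
    fun p hp => ?_, Or.inl ?_, fun V hV => ?_⟩
  · have hpI : Ioo (-δ) δ ×ˢ Ioo 0 δ ⊆ Ioo (-δ) δ ×ˢ Ico 0 δ :=
      prod_mono_right Ioo_subset_Ico_self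
    have hnhds : Ioo (-δ) δ ×ˢ Ioo 0 δ ∈ 𝓝 p := (isOpen_Ioo.prod isOpen_Ioo).mem_nhds hp
    have hpU := (hbox p (hpI hp)).2
    have hcomp := (((hasDerivWithinAt_flatExp 1 (hmaps (hpI hp))).hasFDerivWithinAt.restrictScalars
      ℝ).comp p (hZdiff p hpU).hasFDerivAt.hasFDerivWithinAt
        (hmaps.mono_left hpI)).hasFDerivAt hnhds
    have hLp := hL p hpU
    rw [pdx, pdy] at hLp ⊢
    rw [hcomp.fderiv]
    simp only [ContinuousLinearMap.comp_apply, ContinuousLinearMap.coe_restrictScalars',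
      ContinuousLinearMap.toSpanSingleton_apply, smul_eq_mul]
    linear_combination flatExp (flatExpDeriv 1) (Z p) * hLp
  · have hsub : Ioo (-δ) 0 ⊆ {x ∈ Ioo (-δ) δ | (flatExp 1 ∘ Z) (x, 0) = 0} := fun x hx => by
      have hx' : x ∈ Ioo (-δ) δ := ⟨hx.1, hx.2.trans hδ⟩
      refine ⟨hx', flatExp_of_re_nonpos _ (re_neg_of_norm_sub_le
        (hest (x, 0) ⟨hx', le_rfl, hδ⟩) ?_).le⟩
      simpa [hg0] using hx.2
    refine lt_of_lt_of_le ?_ (measure_mono hsub)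
    simp [hδ]
  · have hright : Tendsto (fun y => (g y + y, y)) (𝓝[>] 0) (𝓝 (0, 0)) := by
      have := (hgc.add continuousAt_id).prodMk (continuousAt_id (x := (0 : ℝ)))
      simp only [ContinuousAt, Pi.add_apply, hg0, id, add_zero] at this
      exact this.mono_left nhdsWithin_le_nhds
    have hx : Ioo (-δ) δ ×ˢ univ ∈ 𝓝 ((0, 0) : ℝ × ℝ) :=
      prod_mem_nhds (Ioo_mem_nhds (by linarith) hδ) univ_mem
    obtain ⟨y, hyV, hyδ, hy⟩ := ((hright.eventually hV).and
      ((hright.eventually hx).and (Ioo_mem_nhdsGT hδ))).exists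
    refine ⟨(g y + y, y), ⟨⟨hyδ.1, hy⟩, hyV⟩, ?_⟩
    have hre := re_pos_of_norm_sub_le (hest (g y + y, y) ⟨hyδ.1, hy.1.le, hy.2⟩)
      (by simpa using hy.1)
    rw [Function.comp_apply, flatExp_of_re_pos _ hre, Polynomial.eval_one, one_mul]
    exact exp_ne_zero _
end

section
/- Let a : ℝ² → ℂ be smooth on (−a₀,a₀)×(−b₀,b₀) (not necessarily locally integrable) and L = ∂/∂y + a(x,y)∂/∂x. Let f be a bounded measurable function on (−a₀,a₀)×(0,b₀) satisfying Lf = 0 in the sense of distributions. Then f admits a weak boundary value: there exist bf ∈ L^∞(−a₀,a₀) and a Lebesgue-null set N ⊂ (0,b₀) such that for every φ ∈ C_c^∞(−a₀,a₀), ∫ f(x,y)φ(x) dx → ∫ bf(x)φ(x) dx as y → 0⁺ with y ∉ N. -/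
open MeasureTheory Set Filter Topology Complex

/-- `u` satisfies `Lu = 0` in the sense of distributions on `Ω`, where
`L = ∂/∂y + a ∂/∂x`. -/
def IsDistribSol (a u : ℝ × ℝ → ℂ) (Ω : Set (ℝ × ℝ)) : Prop :=
  ∀ ψ : ℝ × ℝ → ℂ, ContDiff ℝ (⊤ : ℕ∞) ψ → HasCompactSupport ψ → tsupport ψ ⊆ Ω →
    ∫ p in Ω, u p * (pdy ψ p + pdx (fun q => a q * ψ q) p) = 0

/-- A uniformly bounded family of functions on a finite measure space converges weakly along any
ultrafilter, and the limit obeys the same bound. -/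
lemma exists_bounded_weak_limit {X ι : Type*} [MeasurableSpace X] (μ : Measure X)
    [IsFiniteMeasure μ] (F : ι → X → ℂ) (C : ℝ) (hC : 0 ≤ C)
    (hF : ∀ i, Measurable (F i)) (hb : ∀ i x, ‖F i x‖ ≤ C) (U : Ultrafilter ι) :
    ∃ g : X → ℂ, Measurable g ∧ (∀ x, ‖g x‖ ≤ C) ∧
      ∀ φ : X → ℂ, MemLp φ 2 μ →
        Tendsto (fun i => ∫ x, F i x * φ x ∂μ) U (𝓝 (∫ x, g x * φ x ∂μ)) := by
  have hmem (i : ι) : MemLp (fun x => (starRingEnd ℂ) (F i x)) 2 μ :=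
    MemLp.of_bound (by fun_prop) C (by simp [hb])
  let v : ι → Lp ℂ 2 μ := fun i => (hmem i).toLp
  obtain ⟨R, hR⟩ : ∃ R, ∀ i, ‖v i‖ ≤ R := ⟨_, fun i => Lp.norm_le_of_ae_bound hC (by
    filter_upwards [(hmem i).coeFn_toLp] with x hx
    simp [v, hx, hb])⟩
  let T : ι → WeakDual ℂ (Lp ℂ 2 μ) := fun i =>
    StrongDual.toWeakDual (InnerProductSpace.toDual ℂ _ (v i))
  have hT : ∀ i, T i ∈ WeakDual.toStrongDual ⁻¹' Metric.closedBall
      (0 : StrongDual ℂ (Lp ℂ 2 μ)) R := by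
    intro i
    simpa [T] using hR i
  obtain ⟨ℓ, -, hℓ⟩ := (WeakDual.isCompact_closedBall (𝕜 := ℂ) (0 : StrongDual ℂ (Lp ℂ 2 μ)) R
    ).ultrafilter_le_nhds (U.map T) (by
      exact le_principal_iff.2 (mem_map.2 (univ_mem' hT)))
  let w : Lp ℂ 2 μ := (InnerProductSpace.toDual ℂ _).symm (WeakDual.toStrongDual ℓ)
  let g₀ : X → ℂ := fun x => (starRingEnd ℂ) (w x)
  have hw : MemLp w 2 μ := Lp.memLp w
  have hg₀ : MemLp g₀ 2 μ := hw.star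
  have hlim : ∀ φ : X → ℂ, MemLp φ 2 μ →
      Tendsto (fun i => ∫ x, F i x * φ x ∂μ) U (𝓝 (∫ x, g₀ x * φ x ∂μ)) := by
    intro φ hφ
    have h1 : Tendsto (fun i => T i hφ.toLp) U (𝓝 (ℓ hφ.toLp)) :=
      ((WeakDual.eval_continuous (𝕜 := ℂ) (hφ.toLp)).tendsto ℓ).comp hℓ
    have h2 : ∀ i, T i hφ.toLp = ∫ x, F i x * φ x ∂μ := by
      intro i
      change inner ℂ (v i) hφ.toLp = _
      rw [L2.inner_def]
      apply integral_congr_ae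
      filter_upwards [(hmem i).coeFn_toLp, hφ.coeFn_toLp] with x hx hx'
      simp [v, hx, hx', mul_comm]
    have h3 : ℓ hφ.toLp = ∫ x, g₀ x * φ x ∂μ := by
      have : inner ℂ w hφ.toLp = ℓ hφ.toLp := InnerProductSpace.toDual_symm_apply
      rw [← this, L2.inner_def]
      apply integral_congr_ae
      filter_upwards [hφ.coeFn_toLp] with x hx'
      simp [g₀, hx', mul_comm]
    simpa only [h2, h3] using h1
  have hbound : ∀ φ : X → ℂ, MemLp φ 2 μ → ‖∫ x, g₀ x * φ x ∂μ‖ ≤ ∫ x, C * ‖φ x‖ ∂μ := by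
    intro φ hφ
    refine le_of_tendsto (hlim φ hφ).norm (Eventually.of_forall fun i => ?_)
    refine norm_integral_le_of_norm_le ((hφ.integrable (by norm_num)).norm.const_mul C)
      (Eventually.of_forall fun x => ?_)
    rw [norm_mul]
    gcongr
    exact hb i x
  have hae : ∀ᵐ x ∂μ, ‖g₀ x‖ ≤ C := by
    have key : (fun x => ‖g₀ x‖ ^ 2) ≤ᵐ[μ] fun x => C * ‖g₀ x‖ := by
      refine ae_le_of_forall_setIntegral_le hg₀.norm.integrable_sq
        ((hg₀.integrable (by norm_num)).norm.const_mul C) fun s hs _ => ?_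
      have := hbound (s.indicator fun x => w x) (hw.indicator hs)
      have e1 : ∫ x, g₀ x * s.indicator (fun x => w x) x ∂μ
          = ((∫ x in s, ‖g₀ x‖ ^ 2 ∂μ : ℝ) : ℂ) := by
        rw [← integral_indicator hs, ← integral_complex_ofReal]
        refine integral_congr_ae (Eventually.of_forall fun x => ?_)
        by_cases hx : x ∈ s <;> simp [hx, g₀, Complex.conj_mul']
      have e2 : ∫ x, C * ‖s.indicator (fun x => w x) x‖ ∂μ = ∫ x in s, C * ‖g₀ x‖ ∂μ := by
        rw [← integral_indicator hs]
        refine integral_congr_ae (Eventually.of_forall fun x => ?_)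
        by_cases hx : x ∈ s <;> simp [hx, g₀]
      rw [e1, e2, Complex.norm_real] at this
      exact (le_abs_self _).trans this
    filter_upwards [key] with x hx
    by_contra! h
    nlinarith [norm_nonneg (g₀ x)]
  let g₁ := hg₀.1.mk
  have hg₁ : g₀ =ᵐ[μ] g₁ := hg₀.1.ae_eq_mk
  have hg₁m : Measurable g₁ := hg₀.1.stronglyMeasurable_mk.measurable
  refine ⟨{x | ‖g₁ x‖ ≤ C}.indicator g₁,
    hg₁m.indicator (measurableSet_le hg₁m.norm measurable_const), fun x => ?_, fun φ hφ => ?_⟩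
  · by_cases hx : ‖g₁ x‖ ≤ C <;> simp [indicator, hx, hC]
  · convert hlim φ hφ using 2
    apply integral_congr_ae
    filter_upwards [hg₁, hae] with x hx hx'
    rw [hx] at hx'
    simp [indicator, hx', hx]

/-- A locally integrable function whose weak derivative is bounded by `M` on an interval is
almost everywhere equal to an `M`-Lipschitz function there. -/
lemma exists_null_lipschitz_of_weak_deriv_bound (F : ℝ → ℂ) (hF : LocallyIntegrable F volume)
    (b M : ℝ)
    (h : ∀ η : ℝ → ℝ, ContDiff ℝ (⊤ : ℕ∞) η → HasCompactSupport η → tsupport η ⊆ Ioo 0 b →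
      ‖∫ y, (deriv η y) • F y‖ ≤ M * ∫ y, |η y|) :
    ∃ N : Set ℝ, volume N = 0 ∧ ∀ s ∈ Ioo 0 b \ N, ∀ t ∈ Ioo 0 b \ N,
      ‖F s - F t‖ ≤ M * |s - t| := by
  let ρ : ℕ → ContDiffBump (0 : ℝ) := fun n =>
    ⟨1 / (n + 1), 2 / (n + 1), by positivity, by gcongr; norm_num⟩
  have hρ : Tendsto (fun n => (ρ n).rOut) atTop (𝓝 0) := by
    have := (tendsto_one_div_add_atTop_nhds_zero_nat (𝕜 := ℝ)).const_mul 2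
    simpa [ρ, div_eq_mul_inv] using this
  have hae := ContDiffBump.ae_convolution_tendsto_right_of_locallyIntegrable (K := 2) hρ
    (Eventually.of_forall fun n => by simp [ρ, div_eq_mul_inv]) hF
  let G : ℕ → ℝ → ℂ := fun n x => MeasureTheory.convolution ((ρ n).normed volume) F
    (ContinuousLinearMap.lsmul ℝ ℝ) volume x
  have hcs (n : ℕ) : HasCompactSupport ((ρ n).normed volume) := (ρ n).hasCompactSupport_normed
  have hsm (n : ℕ) : ContDiff ℝ (⊤ : ℕ∞) ((ρ n).normed volume) := (ρ n).contDiff_normed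
  have hd (n : ℕ) (x : ℝ) : HasDerivAt (G n) (MeasureTheory.convolution
      (deriv ((ρ n).normed volume)) F (ContinuousLinearMap.lsmul ℝ ℝ) volume x) x :=
    HasCompactSupport.hasDerivAt_convolution_left _ (hcs n) ((hsm n).of_le (by norm_cast)) hF x
  have hdb (n : ℕ) (x : ℝ) (hx : x ∈ Ioo (ρ n).rOut (b - (ρ n).rOut)) : ‖MeasureTheory.convolution
      (deriv ((ρ n).normed volume)) F (ContinuousLinearMap.lsmul ℝ ℝ) volume x‖ ≤ M := by
    let η : ℝ → ℝ := fun y => (ρ n).normed volume (x - y)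
    have hηs : ContDiff ℝ (⊤ : ℕ∞) η := (hsm n).comp (by fun_prop)
    have hηsupp : tsupport η ⊆ Icc (x - (ρ n).rOut) (x + (ρ n).rOut) := by
      refine closure_minimal (fun y hy => ?_) isClosed_Icc
      have : x - y ∈ Function.support ((ρ n).normed volume) := hy
      rw [ContDiffBump.support_normed_eq] at this
      simp only [Metric.mem_ball, dist_zero_right, Real.norm_eq_abs, abs_lt] at this
      constructor <;> linarith
    have hηc : HasCompactSupport η :=
      HasCompactSupport.of_support_subset_isCompact isCompact_Icc
        ((subset_tsupport _).trans hηsupp)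
    have := h η hηs hηc (hηsupp.trans fun y hy => ⟨by linarith [hx.1, hy.1], by linarith [hx.2, hy.2]⟩)
    have hint : ∫ y, |η y| = 1 := by
      have : ∀ y, |η y| = (ρ n).normed volume (x - y) := fun y =>
        abs_of_nonneg ((ρ n).nonneg_normed _)
      simp_rw [this]
      rw [integral_sub_left_eq_self (fun y => (ρ n).normed volume y)]
      exact (ρ n).integral_normed
    rw [hint, mul_one] at this
    convert this using 1
    rw [convolution_eq_swap, ← norm_neg, ← integral_neg]
    congr 1
    apply integral_congr_ae (Eventually.of_forall fun y => ?_)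
    have : deriv η y = - deriv ((ρ n).normed volume) (x - y) := deriv_comp_const_sub _ _ _
    simp [this]
  refine ⟨{x | ¬ Tendsto (fun n => G n x) atTop (𝓝 (F x))}, hae, ?_⟩
  rintro s ⟨hs, hsN⟩ t ⟨ht, htN⟩
  simp only [mem_ofPred_eq, not_not] at hsN htN
  refine le_of_tendsto (hsN.sub htN).norm ?_
  have hev : ∀ u ∈ Ioo 0 b, ∀ᶠ n in atTop, u ∈ Ioo (ρ n).rOut (b - (ρ n).rOut) := by
    intro u hu
    filter_upwards [hρ.eventually_lt_const hu.1, hρ.eventually_lt_const (sub_pos.2 hu.2)]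
      with n h1 h2
    exact ⟨h1, by linarith⟩
  filter_upwards [hev s hs, hev t ht] with n h1 h2
  exact (convex_Ioo _ _).norm_image_sub_le_of_norm_hasDerivWithin_le
    (fun x _ => (hd n x).hasDerivWithinAt) (hdb n) h2 h1

/-- Any set of integrable functions on a separable measure space has a countable subset that is
dense in it for the `L¹` distance. -/
lemma exists_countable_subset_L1_dense {X : Type*} [MeasurableSpace X] (μ : Measure X)
    [IsSeparable μ] (S : Set (X → ℂ)) (hS : ∀ φ ∈ S, Integrable φ μ) :
    ∃ D ⊆ S, D.Countable ∧ ∀ φ ∈ S, ∀ ε > 0, ∃ χ ∈ D, ∫ x, ‖φ x - χ x‖ ∂μ < ε := by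
  let J : S → Lp ℂ 1 μ := fun φ => (hS φ φ.2).toL1 φ
  have : Fact ((1 : ENNReal) ≠ ⊤) := ⟨by simp⟩
  obtain ⟨t, hts, htc, htd⟩ :=
    (TopologicalSpace.IsSeparable.of_separableSpace (range J)).exists_countable_dense_subset
  obtain ⟨D, hD, hDJ⟩ : ∃ D : Set S, D.Countable ∧ J '' D = t := by
    choose r hr using hts
    have := htc.to_subtype
    exact ⟨range fun z : t => r z.2, countable_range _, by simp [← range_comp, Function.comp_def, hr]⟩
  refine ⟨Subtype.val '' D, by simp, hD.image _, fun φ hφ ε hε => ?_⟩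
  obtain ⟨_, hχt, hχ⟩ := Metric.mem_closure_iff.1 (htd (mem_range_self (⟨φ, hφ⟩ : S))) ε hε
  rw [← hDJ] at hχt
  obtain ⟨χ, hχD, rfl⟩ := hχt
  refine ⟨χ, mem_image_of_mem _ hχD, ?_⟩
  convert hχ using 1
  rw [dist_eq_norm, L1.norm_eq_integral_norm]
  apply integral_congr_ae
  filter_upwards [Lp.coeFn_sub (J ⟨φ, hφ⟩) (J χ), (hS φ hφ).coeFn_toL1, (hS χ χ.2).coeFn_toL1]
    with x h1 h2 h3
  rw [h1, Pi.sub_apply, h2, h3]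

/-- If `φ` has compact support in an open interval `I` and `a` is smooth on `I × (-b₀, b₀)`, then
`∂ₓ(aφ)` is bounded on `ℝ × [0, b]` for `b < b₀`. -/
lemma exists_pdx_bound (I : Set ℝ) (hI : IsOpen I) (b b₀ : ℝ) (hb : 0 < b) (hbb : b < b₀)
    (a : ℝ × ℝ → ℂ) (ha : ContDiffOn ℝ (⊤ : ℕ∞) a (I ×ˢ Ioo (-b₀) b₀))
    (φ : ℝ → ℂ) (hφ : ContDiff ℝ (⊤ : ℕ∞) φ) (hc : HasCompactSupport φ) (hs : tsupport φ ⊆ I) :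
    ∃ K : ℝ, 0 ≤ K ∧ ∀ p : ℝ × ℝ, p.2 ∈ Icc 0 b → ‖pdx (fun q => a q * φ q.1) p‖ ≤ K := by
  have ho : IsOpen (I ×ˢ Ioo (-b₀) b₀) := hI.prod isOpen_Ioo
  have hcd : ContDiffOn ℝ (⊤ : ℕ∞) (fun q : ℝ × ℝ => a q * φ q.1) (I ×ˢ Ioo (-b₀) b₀) :=
    ha.mul (hφ.comp contDiff_fst).contDiffOn
  have hcont : ContinuousOn (pdx (fun q : ℝ × ℝ => a q * φ q.1)) (I ×ˢ Ioo (-b₀) b₀) :=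
    (hcd.continuousOn_fderiv_of_isOpen ho (by norm_cast)).clm_apply continuousOn_const
  obtain ⟨K, hK⟩ := (hc.isCompact.prod (isCompact_Icc (a := (0 : ℝ)) (b := b))
    ).exists_bound_of_continuousOn (hcont.mono (prod_mono hs fun y hy =>
      ⟨by linarith [hy.1], by linarith [hy.2]⟩))
  refine ⟨max K 0, le_max_right _ _, fun p hp => ?_⟩
  by_cases hpx : p.1 ∈ tsupport φ
  · exact (hK p ⟨hpx, hp⟩).trans (le_max_left _ _)
  · have : (fun q : ℝ × ℝ => a q * φ q.1) =ᶠ[𝓝 p] fun _ => 0 := by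
      filter_upwards [(continuous_fst.tendsto p).eventually
        (notMem_tsupport_iff_eventuallyEq.1 hpx)] with q hq
      simp [hq]
    simp [pdx, this.fderiv_eq]

/-- The slice integrals of a bounded solution against a fixed test function converge at the boundary,
off a null set of heights. -/
lemma exists_null_tendsto_slice_integral
    (a₀ b₀ : ℝ) (hb₀ : 0 < b₀)
    (a : ℝ × ℝ → ℂ) (ha : ContDiffOn ℝ (⊤ : ℕ∞) a (Ioo (-a₀) a₀ ×ˢ Ioo (-b₀) b₀))
    (f : ℝ × ℝ → ℂ) (hf_meas : Measurable f)
    (C : ℝ) (hC : 0 ≤ C) (hf_bdd : ∀ p, ‖f p‖ ≤ C)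
    (hsol : IsDistribSol a f (Ioo (-a₀) a₀ ×ˢ Ioo 0 b₀))
    (φ : ℝ → ℂ) (hφ : ContDiff ℝ (⊤ : ℕ∞) φ) (hc : HasCompactSupport φ)
    (hs : tsupport φ ⊆ Ioo (-a₀) a₀) :
    ∃ N : Set ℝ, volume N = 0 ∧ ∃ L : ℂ,
      Tendsto (fun y => ∫ x in Ioo (-a₀) a₀, f (x, y) * φ x) (𝓝[Ioo 0 b₀ \ N] 0) (𝓝 L) := by
  set I := Ioo (-a₀) a₀
  obtain ⟨K, hK0, hK⟩ := exists_pdx_bound I isOpen_Ioo (b₀ / 2) b₀ (by linarith) (by linarith)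
    a ha φ hφ hc hs
  let F : ℝ → ℂ := fun y => ∫ x in I, f (x, y) * φ x
  have hφi : Integrable φ volume := hφ.continuous.integrable_of_hasCompactSupport hc
  have hφm : Measurable φ := hφ.continuous.measurable
  have hFm : StronglyMeasurable F :=
    StronglyMeasurable.integral_prod_right' (f := fun q : ℝ × ℝ => f (q.2, q.1) * φ q.2)
      (Measurable.stronglyMeasurable (by fun_prop))
  have hFb : ∀ y, ‖F y‖ ≤ ∫ x in I, C * ‖φ x‖ := fun y =>
    norm_integral_le_of_norm_le (hφi.norm.const_mul C).integrableOn
      (Eventually.of_forall fun x => by rw [norm_mul]; gcongr; exact hf_bdd _)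
  have hFl : LocallyIntegrable F volume :=
    (locallyIntegrable_const (∫ x in I, C * ‖φ x‖)).mono hFm.aestronglyMeasurable
      (Eventually.of_forall fun y => (hFb y).trans (le_abs_self _))
  obtain ⟨N, hN, hlip⟩ := exists_null_lipschitz_of_weak_deriv_bound F hFl (b₀ / 2)
    (C * K * volume.real I) (by
    intro η hη hηc hηs
    have hηs' : tsupport η ⊆ Ioo 0 b₀ :=
      hηs.trans (Ioo_subset_Ioo_right (by linarith))
    have hηi : Integrable η volume := hη.continuous.integrable_of_hasCompactSupport hηc
    have hη'c : Continuous (deriv η) := hη.continuous_deriv (by norm_cast)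
    have hη'i : Integrable (deriv η) volume := hη'c.integrable_of_hasCompactSupport hηc.deriv
    let ψ : ℝ × ℝ → ℂ := fun p => φ p.1 * (η p.2 : ℂ)
    have hψ : ContDiff ℝ (⊤ : ℕ∞) ψ :=
      (hφ.comp contDiff_fst).mul (Complex.ofRealCLM.contDiff.comp (hη.comp contDiff_snd))
    have hψs : tsupport ψ ⊆ tsupport φ ×ˢ tsupport η := by
      refine closure_minimal (fun p hp => ?_) ((isClosed_tsupport _).prod (isClosed_tsupport _))
      have : φ p.1 * (η p.2 : ℂ) ≠ 0 := hp
      simp only [ne_eq, mul_eq_zero, not_or, ofReal_eq_zero] at this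
      exact ⟨subset_tsupport _ this.1, subset_tsupport _ this.2⟩
    have hψc : HasCompactSupport ψ :=
      HasCompactSupport.of_support_subset_isCompact (hc.isCompact.prod hηc.isCompact)
        ((subset_tsupport _).trans hψs)
    have h0 := hsol ψ hψ hψc (hψs.trans (prod_mono hs hηs'))
    let H : ℝ × ℝ → ℂ := pdx fun q => a q * φ q.1
    have hHm : Measurable H := measurable_fderiv_apply_const ℝ _ _
    let A : ℝ × ℝ → ℂ := fun p => f p * (φ p.1 * ((deriv η p.2 : ℝ) : ℂ))
    let B : ℝ × ℝ → ℂ := fun p => f p * (H p * (η p.2 : ℂ))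
    have hηm : Measurable η := hη.continuous.measurable
    have hη'm : Measurable (deriv η) := hη'c.measurable
    have hIfin : volume I ≠ ⊤ := by simp [I]
    have hA : IntegrableOn A (I ×ˢ Ioo 0 b₀) volume := by
      have : Integrable (fun p : ℝ × ℝ => φ p.1 * ((deriv η p.2 : ℝ) : ℂ)) volume :=
        hφi.mul_prod hη'i.ofReal
      exact (this.bdd_mul hf_meas.aestronglyMeasurable
        (Eventually.of_forall hf_bdd)).integrableOn
    have hmajor : IntegrableOn (fun p : ℝ × ℝ => (C * K) * |η p.2|) (I ×ˢ Ioo 0 b₀) volume := by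
      have h1 : IntegrableOn (fun _ : ℝ => C * K) I volume := integrableOn_const hIfin
      have := Integrable.mul_prod h1 (hηi.abs.integrableOn (s := Ioo 0 b₀))
      rwa [Measure.prod_restrict] at this
    have hBle : ∀ p, ‖B p‖ ≤ (C * K) * |η p.2| := by
      intro p
      by_cases hp : p.2 ∈ Icc 0 (b₀ / 2)
      · have h1 := hf_bdd p
        have h2 : ‖H p‖ ≤ K := hK p hp
        simp only [B, norm_mul, Complex.norm_real, Real.norm_eq_abs]
        rw [← mul_assoc]
        gcongr
      · have : η p.2 = 0 := image_eq_zero_of_notMem_tsupport fun h =>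
          hp (Ioo_subset_Icc_self (hηs h))
        simp [B, this]
    have hB : IntegrableOn B (I ×ˢ Ioo 0 b₀) volume :=
      hmajor.mono' (by fun_prop) (Eventually.of_forall hBle)
    have hAB : ∫ p in I ×ˢ Ioo 0 b₀, A p = - ∫ p in I ×ˢ Ioo 0 b₀, B p := by
      rw [eq_neg_iff_add_eq_zero, ← integral_add hA hB, ← h0]
      refine setIntegral_congr_fun (measurableSet_Ioo.prod measurableSet_Ioo) fun p hp => ?_
      have d1 : DifferentiableAt ℝ (fun q : ℝ × ℝ => a q * φ q.1) p := by
        have : DifferentiableAt ℝ a p := (ha.differentiableOn (by simp)).differentiableAt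
          ((isOpen_Ioo.prod isOpen_Ioo).mem_nhds ⟨hp.1, by linarith [hp.2.1], hp.2.2⟩)
        exact this.mul ((hφ.differentiable (by simp)).differentiableAt.comp p differentiableAt_fst)
      have d2 : HasFDerivAt (fun q : ℝ × ℝ => (η q.2 : ℂ))
          ((Complex.ofRealCLM.comp (ContinuousLinearMap.toSpanSingleton ℝ (deriv η p.2))).comp
            (ContinuousLinearMap.snd ℝ ℝ ℝ)) p :=
        (Complex.ofRealCLM.hasFDerivAt.comp _
          ((hη.differentiable (by simp)).differentiableAt.hasDerivAt.hasFDerivAt)).comp p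
          hasFDerivAt_snd
      have d3 : HasFDerivAt (fun q : ℝ × ℝ => φ q.1)
          ((ContinuousLinearMap.toSpanSingleton ℝ (deriv φ p.1)).comp
            (ContinuousLinearMap.fst ℝ ℝ ℝ)) p :=
        ((hφ.differentiable (by simp)).differentiableAt.hasDerivAt.hasFDerivAt).comp p
          hasFDerivAt_fst
      have e1 : pdy ψ p = φ p.1 * ((deriv η p.2 : ℝ) : ℂ) := by
        simp [pdy, ψ, (d3.fun_mul d2).fderiv]
      have e2 : pdx (fun q => a q * ψ q) p = H p * (η p.2 : ℂ) := by
        have : (fun q => a q * ψ q) = fun q => (a q * φ q.1) * (η q.2 : ℂ) := by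
          ext q; simp [ψ, mul_assoc]
        rw [this, pdx, (d1.hasFDerivAt.fun_mul d2).fderiv]
        simp [H, pdx, mul_comm]
      simp only [A, B, e1, e2]
      ring
    have hAF : ∫ y, deriv η y • F y = ∫ p in I ×ˢ Ioo 0 b₀, A p := by
      have hA' := hA
      rw [IntegrableOn, Measure.volume_eq_prod, ← Measure.prod_restrict] at hA'
      rw [Measure.volume_eq_prod, ← Measure.prod_restrict, integral_prod_symm _ hA',
        ← setIntegral_eq_integral_of_forall_compl_eq_zero (s := Ioo 0 b₀)]
      · refine integral_congr_ae (Eventually.of_forall fun y => ?_)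
        simp only [F, A, Complex.real_smul, ← integral_const_mul]
        congr 1; ext x; ring
      · intro y hy
        have : deriv η y = 0 := image_eq_zero_of_notMem_tsupport fun h =>
          hy (hηs' (tsupport_deriv_subset h))
        simp [this]
    rw [hAF, hAB, norm_neg]
    calc ‖∫ p in I ×ˢ Ioo 0 b₀, B p‖ ≤ ∫ p in I ×ˢ Ioo 0 b₀, (C * K) * |η p.2| :=
          norm_integral_le_of_norm_le hmajor (Eventually.of_forall hBle)
      _ = (∫ x in I, C * K) * ∫ y in Ioo 0 b₀, |η y| := by
          rw [Measure.volume_eq_prod]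
          exact setIntegral_prod_mul (fun _ => C * K) (fun y => |η y|) I (Ioo 0 b₀)
      _ = C * K * volume.real I * ∫ y in Ioo 0 b₀, |η y| := by
          simp [mul_comm]
      _ ≤ C * K * volume.real I * ∫ y, |η y| := by
          refine mul_le_mul_of_nonneg_left ?_ (by positivity)
          exact setIntegral_le_integral hηi.abs (Eventually.of_forall fun y => abs_nonneg _))
  refine ⟨N, hN, ?_⟩
  rcases eq_or_neBot (𝓝[Ioo 0 b₀ \ N] (0 : ℝ)) with h | hne
  · exact ⟨0, h ▸ tendsto_bot⟩
  refine cauchy_map_iff_exists_tendsto.1 ?_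
  rw [Metric.cauchy_iff]
  refine ⟨inferInstance, fun ε hε => ?_⟩
  set M := C * K * volume.real I
  have hM : 0 ≤ M := by positivity
  obtain ⟨δ, hδ, hδM⟩ : ∃ δ > 0, M * δ < ε := exists_pos_mul_lt hε M
  have hev : ∀ᶠ y in 𝓝[Ioo 0 b₀ \ N] (0 : ℝ), y ∈ Ioo 0 (b₀ / 2) \ N ∧ y < δ := by
    filter_upwards [self_mem_nhdsWithin,
      mem_nhdsWithin_of_mem_nhds (Iio_mem_nhds (show (0 : ℝ) < b₀ / 2 by linarith)),
      mem_nhdsWithin_of_mem_nhds (Iio_mem_nhds hδ)] with y h1 h2 h3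
    exact ⟨⟨⟨h1.1.1, h2⟩, h1.2⟩, h3⟩
  refine ⟨_, image_mem_map hev, ?_⟩
  rintro _ ⟨s, ⟨hs1, hs2⟩, rfl⟩ _ ⟨t, ⟨ht1, ht2⟩, rfl⟩
  rw [dist_eq_norm]
  refine (hlip s hs1 t ht1).trans_lt (lt_of_le_of_lt ?_ hδM)
  gcongr
  rw [abs_le]
  constructor <;> linarith [hs1.1.1, ht1.1.1]

/-- Lemma 1.1: a bounded distributional solution of `Lf = 0` on
`(-a₀,a₀) × (0,b₀)` admits a weak boundary value `bf ∈ L^∞(-a₀,a₀)`. -/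
theorem weak_boundary_value_exists
    (a₀ b₀ : ℝ) (ha₀ : 0 < a₀) (hb₀ : 0 < b₀)
    (a : ℝ × ℝ → ℂ) (ha : ContDiffOn ℝ (⊤ : ℕ∞) a (Ioo (-a₀) a₀ ×ˢ Ioo (-b₀) b₀))
    (f : ℝ × ℝ → ℂ) (hf_meas : Measurable f)
    (C : ℝ) (hf_bdd : ∀ p ∈ Ioo (-a₀) a₀ ×ˢ Ioo 0 b₀, ‖f p‖ ≤ C)
    (hsol : IsDistribSol a f (Ioo (-a₀) a₀ ×ˢ Ioo 0 b₀)) :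
    ∃ bf : ℝ → ℂ, Measurable bf ∧ (∃ C' : ℝ, ∀ x, ‖bf x‖ ≤ C') ∧
      ∃ N : Set ℝ, N ⊆ Ioo 0 b₀ ∧ volume N = 0 ∧
        ∀ φ : ℝ → ℂ, ContDiff ℝ (⊤ : ℕ∞) φ → HasCompactSupport φ → tsupport φ ⊆ Ioo (-a₀) a₀ →
          Tendsto (fun y => ∫ x in Ioo (-a₀) a₀, f (x, y) * φ x)
            (𝓝[Ioo 0 b₀ \ N] 0) (𝓝 (∫ x in Ioo (-a₀) a₀, bf x * φ x)) := by
  have hC : 0 ≤ C := (norm_nonneg _).trans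
    (hf_bdd (0, b₀ / 2) ⟨⟨by simpa using ha₀, ha₀⟩, ⟨by positivity, by simpa using hb₀⟩⟩)
  set I := Ioo (-a₀) a₀
  set Ω := I ×ˢ Ioo 0 b₀
  have hΩ : MeasurableSet Ω := measurableSet_Ioo.prod measurableSet_Ioo
  let g : ℝ × ℝ → ℂ := Ω.indicator f
  have hgm : Measurable g := hf_meas.indicator hΩ
  have hgb : ∀ p, ‖g p‖ ≤ C := fun p => by
    by_cases hp : p ∈ Ω
    · simpa [g, hp] using hf_bdd p hp
    · simpa [g, hp] using hC
  have hgsol : IsDistribSol a g Ω := fun ψ h1 h2 h3 => by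
    rw [← hsol ψ h1 h2 h3]
    exact setIntegral_congr_fun hΩ fun p hp => by simp [g, hp]
  let S : Set (ℝ → ℂ) :=
    {φ | ContDiff ℝ (⊤ : ℕ∞) φ ∧ HasCompactSupport φ ∧ tsupport φ ⊆ I}
  have hSi : ∀ φ ∈ S, Integrable φ (volume.restrict I) := fun φ hφ =>
    (hφ.1.continuous.integrable_of_hasCompactSupport hφ.2.1).integrableOn
  obtain ⟨D, hDS, hDc, hD⟩ := exists_countable_subset_L1_dense (volume.restrict I) S hSi
  have hex : ∀ φ ∈ D, ∃ N : Set ℝ, volume N = 0 ∧ ∃ L : ℂ,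
      Tendsto (fun y => ∫ x in I, g (x, y) * φ x) (𝓝[Ioo 0 b₀ \ N] 0) (𝓝 L) := fun φ hφ =>
    exists_null_tendsto_slice_integral a₀ b₀ hb₀ a ha g hgm C hC hgb hgsol φ
      (hDS hφ).1 (hDS hφ).2.1 (hDS hφ).2.2
  choose! N₀ hN₀ L hL using hex
  let N : Set ℝ := Ioo 0 b₀ ∩ ⋃ φ ∈ D, N₀ φ
  have hN : volume N = 0 :=
    measure_mono_null inter_subset_right ((measure_biUnion_null_iff hDc).2 hN₀)
  have hle : ∀ φ ∈ D, 𝓝[Ioo 0 b₀ \ N] (0 : ℝ) ≤ 𝓝[Ioo 0 b₀ \ N₀ φ] 0 := fun φ hφ =>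
    nhdsWithin_mono _ fun y hy => ⟨hy.1, fun h => hy.2 ⟨hy.1, mem_biUnion hφ h⟩⟩
  rcases eq_or_neBot (𝓝[Ioo 0 b₀ \ N] (0 : ℝ)) with h | hne
  · exact ⟨0, measurable_zero, ⟨0, by simp⟩, N, inter_subset_left, hN,
      fun _ _ _ _ => h ▸ tendsto_bot⟩
  let U := Ultrafilter.of (𝓝[Ioo 0 b₀ \ N] (0 : ℝ))
  obtain ⟨bf, hbm, hbb, hb⟩ := exists_bounded_weak_limit (volume.restrict I)
    (fun y x => g (x, y)) C hC (fun y => by fun_prop) (fun y x => hgb _) U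
  refine ⟨bf, hbm, ⟨C, hbb⟩, N, inter_subset_left, hN, fun φ h1 h2 h3 => ?_⟩
  have hbound : ∀ u : ℝ → ℂ, Measurable u → (∀ x, ‖u x‖ ≤ C) → ∀ φ ∈ S, ∀ χ ∈ S,
      ‖(∫ x in I, u x * φ x) - ∫ x in I, u x * χ x‖ ≤ C * ∫ x in I, ‖φ x - χ x‖ := by
    intro u hu hub φ hφ χ hχ
    have hi : ∀ φ ∈ S, Integrable (fun x => u x * φ x) (volume.restrict I) := fun φ hφ =>
      (hSi φ hφ).bdd_mul hu.aestronglyMeasurable (Eventually.of_forall hub)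
    rw [← integral_sub (hi φ hφ) (hi χ hχ), ← integral_const_mul]
    refine norm_integral_le_of_norm_le (((hSi φ hφ).sub (hSi χ hχ)).norm.const_mul C)
      (Eventually.of_forall fun x => ?_)
    rw [← mul_sub, norm_mul]
    exact mul_le_mul_of_nonneg_right (hub x) (norm_nonneg _)
  have hφS : φ ∈ S := ⟨h1, h2, h3⟩
  have hlim : Tendsto (fun y => ∫ x in I, g (x, y) * φ x) (𝓝[Ioo 0 b₀ \ N] 0)
      (𝓝 (∫ x in I, bf x * φ x)) := by
    rw [Metric.tendsto_nhds]
    intro ε hε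
    obtain ⟨δ, hδ, hδC⟩ : ∃ δ > 0, C * δ < ε / 3 := exists_pos_mul_lt (by positivity) C
    obtain ⟨χ, hχD, hχ⟩ := hD φ hφS δ hδ
    have hχS := hDS hχD
    have hχlim := (hL χ hχD).mono_left (hle χ hχD)
    have hχmem : MemLp χ 2 (volume.restrict I) :=
      (hχS.1.continuous.memLp_of_hasCompactSupport hχS.2.1).restrict I
    rw [tendsto_nhds_unique (hχlim.mono_left (Ultrafilter.of_le _)) (hb χ hχmem)] at hχlim
    filter_upwards [Metric.tendsto_nhds.1 hχlim (ε / 3) (by positivity)] with y hy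
    have hsmall : C * ∫ x in I, ‖φ x - χ x‖ < ε / 3 :=
      (mul_le_mul_of_nonneg_left hχ.le hC).trans_lt hδC
    have e1 := hbound (fun x => g (x, y)) (by fun_prop) (fun x => hgb _) φ hφS χ hχS
    have e2 := hbound bf hbm hbb φ hφS χ hχS
    rw [← dist_eq_norm] at e1 e2
    rw [dist_comm] at e2
    have := dist_triangle4 (∫ x in I, g (x, y) * φ x) (∫ x in I, g (x, y) * χ x)
      (∫ x in I, bf x * χ x) (∫ x in I, bf x * φ x)
    linarith
  refine hlim.congr' ?_
  filter_upwards [self_mem_nhdsWithin] with y hy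
  refine setIntegral_congr_fun measurableSet_Ioo fun x hx => ?_
  have : (x, y) ∈ Ω := ⟨hx, hy.1⟩
  simp [g, this]
end

section
/- Let b₀ > 0, let a : ℝ×[0,b₀] → ℂ be smooth, and let φ ∈ C_c^∞(ℝ;ℂ). Define Φ(x,y) = φ(x) − y·∂_x( a(x,y)·φ(x) ). Then Φ is smooth, Φ(x,0) = φ(x) for all x, Φ(·,y) is supported in supp φ for every y, and there is a constant C (depending only on a and on the derivatives of φ up to order 2 on supp φ × [0,b₀]) such that |∂_y Φ(x,y) + ∂_x( a(x,y)·Φ(x,y) )| ≤ C·y for all (x,y) ∈ ℝ×[0,b₀]; that is, |L*Φ| ≤ Cy where L* is the formal transpose of L = ∂/∂y + a∂/∂x. -/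
open MeasureTheory Set Filter Topology Complex

/-- The closed strip `ℝ × [0,b₀]`. -/
def strip (b₀ : ℝ) : Set (ℝ × ℝ) := Set.univ ×ˢ Icc 0 b₀

/-- Partial derivative in the `x` direction within the strip. -/
noncomputable def pdxS (b₀ : ℝ) (f : ℝ × ℝ → ℂ) (p : ℝ × ℝ) : ℂ :=
  fderivWithin ℝ f (strip b₀) p (1, 0)

/-- Partial derivative in the `y` direction within the strip. -/
noncomputable def pdyS (b₀ : ℝ) (f : ℝ × ℝ → ℂ) (p : ℝ × ℝ) : ℂ :=
  fderivWithin ℝ f (strip b₀) p (0, 1)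

theorem uniqueDiffOn_strip {b₀ : ℝ} (hb₀ : 0 < b₀) : UniqueDiffOn ℝ (strip b₀) :=
  uniqueDiffOn_univ.prod (uniqueDiffOn_Icc hb₀)

theorem contDiffOn_fderivWithin_strip_apply {b₀ : ℝ} (hb₀ : 0 < b₀) {f : ℝ × ℝ → ℂ}
    (hf : ContDiffOn ℝ (⊤ : ℕ∞) f (strip b₀)) (v : ℝ × ℝ) :
    ContDiffOn ℝ (⊤ : ℕ∞) (fun p => fderivWithin ℝ f (strip b₀) p v) (strip b₀) :=
  (hf.fderivWithin (uniqueDiffOn_strip hb₀) le_rfl).clm_apply contDiffOn_const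

theorem fderivWithin_eq_zero_of_fst_notMem {s : Set (ℝ × ℝ)} {K : Set ℝ} (hK : IsClosed K)
    {f : ℝ × ℝ → ℂ} (hf : ∀ p : ℝ × ℝ, p.1 ∉ K → f p = 0) {p : ℝ × ℝ} (hp : p.1 ∉ K) :
    fderivWithin ℝ f s p = 0 := by
  have hev : f =ᶠ[𝓝[s] p] fun _ => 0 := by
    have hU : {q : ℝ × ℝ | q.1 ∉ K} ∈ 𝓝 p :=
      (hK.isOpen_compl.preimage continuous_fst).mem_nhds hp
    filter_upwards [mem_nhdsWithin_of_mem_nhds hU] with q hq using hf q hq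
  rw [hev.fderivWithin_eq (hf p hp)]
  simp

/-- A continuous function on the strip supported in a compact set of `x` is bounded there. -/
theorem exists_bound_on_strip {b₀ : ℝ} {K : Set ℝ} (hK : IsCompact K) {f : ℝ × ℝ → ℂ}
    (hf : ContinuousOn f (strip b₀)) (hf₀ : ∀ p : ℝ × ℝ, p.1 ∉ K → f p = 0) :
    ∃ C : ℝ, ∀ p ∈ strip b₀, ‖f p‖ ≤ C := by
  obtain ⟨C, hC⟩ := (hK.prod isCompact_Icc).exists_bound_of_continuousOn
    (hf.mono (prod_mono (subset_univ K) Subset.rfl))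
  refine ⟨max C 0, fun p hp => ?_⟩
  by_cases hpK : p.1 ∈ K
  · exact (hC p ⟨hpK, hp.2⟩).trans (le_max_left _ _)
  · simp [hf₀ p hpK]

/-- For `Φ = φ - y g`, the terms of order zero in `y` cancel in `L*Φ` as soon as `g = ∂_x(aφ)`. -/
theorem transpose_apply_sub_mul {b₀ : ℝ} (hb₀ : 0 < b₀) {a g : ℝ × ℝ → ℂ} {φ : ℝ → ℂ}
    {p : ℝ × ℝ} (hp : p ∈ strip b₀) (ha : DifferentiableWithinAt ℝ a (strip b₀) p)
    (hφ : DifferentiableAt ℝ φ p.1) (hg : DifferentiableWithinAt ℝ g (strip b₀) p)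
    (hgp : g p = pdxS b₀ (fun q => a q * φ q.1) p) :
    -(pdyS b₀ (fun q => φ q.1 - q.2 * g q) p) -
        pdxS b₀ (fun q => a q * (φ q.1 - q.2 * g q)) p =
      p.2 * (pdyS b₀ g p + pdxS b₀ (fun q => a q * g q) p) := by
  have hu := uniqueDiffOn_strip hb₀ p hp
  have hφ' : HasFDerivWithinAt (fun q : ℝ × ℝ => φ q.1)
      ((fderiv ℝ φ p.1).comp (ContinuousLinearMap.fst ℝ ℝ ℝ)) (strip b₀) p :=
    hφ.hasFDerivAt.comp_hasFDerivWithinAt p hasFDerivWithinAt_fst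
  have hy : HasFDerivWithinAt (fun q : ℝ × ℝ => (q.2 : ℂ))
      (ofRealCLM.comp (ContinuousLinearMap.snd ℝ ℝ ℝ)) (strip b₀) p :=
    ofRealCLM.hasFDerivAt.comp_hasFDerivWithinAt p hasFDerivWithinAt_snd
  have ha' := ha.hasFDerivWithinAt
  have hg' := hg.hasFDerivWithinAt
  have hΦ := hφ'.fun_sub (hy.fun_mul hg')
  have haφ := (ha'.fun_mul hφ').fderivWithin hu
  have hag := (ha'.fun_mul hg').fderivWithin hu
  have haΦ := (ha'.fun_mul hΦ).fderivWithin hu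
  simp only [pdxS, pdyS] at hgp ⊢
  rw [haφ] at hgp
  rw [hΦ.fderivWithin hu, hag, haΦ]
  simp at hgp ⊢
  linear_combination hgp

/-- Construction of the test function `Φ(x,y) = φ(x) - y ∂_x(aφ)(x,y)`: it is
smooth, restricts to `φ` at `y = 0`, keeps the support of `φ` in `x`, and its
image under the formal transpose `L* = -∂_y - ∂_x(a ·)` is `O(y)`. -/
theorem test_function_construction
    (b₀ : ℝ) (hb₀ : 0 < b₀)
    (a : ℝ × ℝ → ℂ) (ha : ContDiffOn ℝ (⊤ : ℕ∞) a (strip b₀))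
    (φ : ℝ → ℂ) (hφ : ContDiff ℝ (⊤ : ℕ∞) φ) (hφc : HasCompactSupport φ)
    (Φ : ℝ × ℝ → ℂ)
    (hΦ_def : ∀ p : ℝ × ℝ,
      Φ p = φ p.1 - p.2 * pdxS b₀ (fun q => a q * φ q.1) p) :
    ContDiffOn ℝ (⊤ : ℕ∞) Φ (strip b₀) ∧
    (∀ x : ℝ, Φ (x, 0) = φ x) ∧
    (∀ p : ℝ × ℝ, p.1 ∉ tsupport φ → Φ p = 0) ∧
    ∃ C : ℝ, ∀ p ∈ strip b₀,
      ‖-(pdyS b₀ Φ p) - pdxS b₀ (fun q => a q * Φ q) p‖ ≤ C * p.2 := by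
  obtain rfl : Φ = fun p => φ p.1 - p.2 * pdxS b₀ (fun q => a q * φ q.1) p := funext hΦ_def
  clear hΦ_def
  set g : ℝ × ℝ → ℂ := pdxS b₀ (fun q => a q * φ q.1) with hg_def
  have hφ_fst : ContDiffOn ℝ (⊤ : ℕ∞) (fun q : ℝ × ℝ => φ q.1) (strip b₀) :=
    (hφ.comp contDiff_fst).contDiffOn
  have hy : ContDiffOn ℝ (⊤ : ℕ∞) (fun q : ℝ × ℝ => (q.2 : ℂ)) (strip b₀) :=
    (ofRealCLM.contDiff.comp contDiff_snd).contDiffOn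
  have hg : ContDiffOn ℝ (⊤ : ℕ∞) g (strip b₀) :=
    contDiffOn_fderivWithin_strip_apply hb₀ (ha.mul hφ_fst) (1, 0)
  have hK : IsClosed (tsupport φ) := isClosed_tsupport φ
  have hφ₀ : ∀ x, x ∉ tsupport φ → φ x = 0 := fun x hx => image_eq_zero_of_notMem_tsupport hx
  have hg₀ : ∀ p : ℝ × ℝ, p.1 ∉ tsupport φ → g p = 0 := fun p hp => by
    simp only [hg_def, pdxS]
    rw [fderivWithin_eq_zero_of_fst_notMem hK (fun q hq => by simp [hφ₀ _ hq]) hp]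
    rfl
  refine ⟨hφ_fst.sub (hy.mul hg), fun x => by simp, fun p hp => by simp [hφ₀ _ hp, hg₀ _ hp], ?_⟩
  obtain ⟨C, hC⟩ := exists_bound_on_strip (b₀ := b₀) hφc
    (f := fun p => pdyS b₀ g p + pdxS b₀ (fun q => a q * g q) p)
    ((contDiffOn_fderivWithin_strip_apply hb₀ hg (0, 1)).add
      (contDiffOn_fderivWithin_strip_apply hb₀ (ha.mul hg) (1, 0))).continuousOn
    (fun p hp => by
      simp only [pdxS, pdyS]
      rw [fderivWithin_eq_zero_of_fst_notMem hK hg₀ hp,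
        fderivWithin_eq_zero_of_fst_notMem hK (fun q hq => by simp [hg₀ _ hq]) hp]
      simp)
  refine ⟨C, fun p hp => ?_⟩
  rw [transpose_apply_sub_mul hb₀ hp (ha.differentiableOn (by simp) p hp)
    (hφ.differentiable (by simp) _) (hg.differentiableOn (by simp) p hp) rfl,
    norm_mul, norm_real, Real.norm_of_nonneg hp.2.1, mul_comm]
  exact mul_le_mul_of_nonneg_right (hC p hp) hp.2.1
end

section
/- There exist a compact set K ⊂ (−1,1) with positive Lebesgue measure, empty interior and no isolated points, and a smooth function b : (−1,1) → ℝ with b(x) = 0 for x ∈ K and b(x) > 0 for x ∈ (−1,1)∖K, such that, setting a(x,y) = −i·b(x)/(1 + i·y·b′(x)) and L = ∂/∂y + a(x,y)∂/∂x on (−1,1)×ℝ (note 1+iyb′(x) never vanishes since b′ is real): (i) Z(x,y) = x + i·y·b(x) satisfies ∂_yZ + a·∂_xZ = 0 and ∂_xZ never vanishes, so L is locally integrable; (ii) the indicator function u(x,y) = χ_K(x) is bounded and satisfies Lu = 0 in the sense of distributions on (−1,1)×ℝ; (iii) for every x₀ ∈ K and every open set V ⊆ ℝ² containing the segment {x₀}×(0,1),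 there exists (x,y) ∈ V with y > 0 and u(x,y) = 0, while u(x₀,y) = 1 for all y; in particular u does not converge to its boundary value χ_K(x₀) = 1 along any full neighborhood of the segment {x₀}×(0,1). -/
open scoped Classical

open MeasureTheory Set Filter Topology Complex

/-- Every nonempty open subset of the line contains a compact set of positive measure, with empty
interior and without isolated points. -/
theorem exists_compact_perfect_nowhere_dense {s : Set ℝ} (hs : IsOpen s) (hne : s.Nonempty) :
    ∃ K : Set ℝ, IsCompact K ∧ K ⊆ s ∧ 0 < volume K ∧
      interior K = ∅ ∧ ∀ x ∈ K, x ∈ closure (K \ {x}) := by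
  have hQ : (range ((↑) : ℚ → ℝ)).Countable := countable_range _
  have hpos : 0 < volume (s \ range ((↑) : ℚ → ℝ)) := by
    rw [measure_sdiff_null (hQ.measure_zero volume)]
    exact hs.measure_pos volume hne
  obtain ⟨C, hCs, hC, hCpos⟩ :=
    (hs.measurableSet.diff hQ.measurableSet).exists_lt_isCompact hpos
  obtain ⟨V, D, hV, hD, rfl⟩ := exists_countable_union_perfect_of_isClosed hC.isClosed
  have hDs : D ⊆ s \ range ((↑) : ℚ → ℝ) := subset_union_right.trans hCs
  refine ⟨D, hC.of_isClosed_subset hD.closed subset_union_right, fun x hx => (hDs hx).1, ?_, ?_, ?_⟩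
  · have := hCpos.trans_le (measure_union_le V D)
    rwa [hV.measure_zero volume, zero_add] at this
  · rw [interior_eq_empty_iff_dense_compl]
    exact Rat.denseRange_cast.mono fun x hx hxD => (hDs hxD).2 hx
  · intro x hx
    rw [mem_closure_iff_clusterPt, ← accPt_principal_iff_clusterPt]
    exact hD.acc x hx

theorem one_add_I_mul_ofReal_mul_ofReal_ne_zero (y t : ℝ) :
    (1 + Complex.I * y * t : ℂ) ≠ 0 := by
  intro h
  simpa using congrArg Complex.re h

/-- The integral of the `y`-derivative of a test function over a vertical strip vanishes. -/
theorem setIntegral_prod_univ_pdy_eq_zero {ψ : ℝ × ℝ → ℂ} (hψ : ContDiff ℝ (⊤ : ℕ∞) ψ)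
    (hc : HasCompactSupport ψ) (s : Set ℝ) :
    ∫ p in s ×ˢ (univ : Set ℝ), pdy ψ p = 0 := by
  have hcont : Continuous (pdy ψ) :=
    (hψ.continuous_fderiv (by simp)).clm_apply continuous_const
  have hcs : HasCompactSupport (pdy ψ) := hc.fderiv_apply (𝕜 := ℝ) (0, 1)
  have hemb (x : ℝ) : IsClosedEmbedding (fun y : ℝ => (x, y)) :=
    Isometry.isClosedEmbedding (.of_dist_eq fun _ _ => by simp [Prod.dist_eq])
  rw [Measure.volume_eq_prod, setIntegral_prod]
  · refine integral_eq_zero_of_ae (Eventually.of_forall fun x => ?_)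
    simp only [setIntegral_univ]
    refine integral_eq_zero_of_hasDerivAt_of_integrable (f := fun y => ψ (x, y)) (fun y => ?_)
      ((hcont.comp (hemb x).continuous).integrable_of_hasCompactSupport
        (hcs.comp_isClosedEmbedding (hemb x)))
      ((hψ.continuous.comp (hemb x).continuous).integrable_of_hasCompactSupport
        (hc.comp_isClosedEmbedding (hemb x)))
    exact ((hψ.differentiable (by simp)) (x, y)).hasFDerivAt.comp_hasDerivAt y
      ((hasDerivAt_const y x).prodMk (hasDerivAt_id y))
  · exact (hcont.integrable_of_hasCompactSupport hcs).integrableOn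

/-- A product with a factor depending on `x` only has zero `x`-derivative over a double zero of
that factor. -/
theorem pdx_ofReal_comp_fst_mul_eq_zero {b : ℝ → ℝ} {g : ℝ × ℝ → ℂ} {p : ℝ × ℝ}
    (hb : HasDerivAt b 0 p.1) (hb0 : b p.1 = 0) (hg : DifferentiableAt ℝ g p) :
    pdx (fun q => (b q.1 : ℂ) * g q) p = 0 := by
  have h1 : HasFDerivAt (fun q : ℝ × ℝ => (b q.1 : ℂ)) (0 : ℝ × ℝ →L[ℝ] ℂ) p := by
    refine (hb.ofReal_comp.hasFDerivAt.comp p hasFDerivAt_fst).congr_fderiv ?_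
    ext <;> simp
  rw [pdx, HasFDerivAt.fderiv (f := fun q => (b q.1 : ℂ) * g q) (h1.mul hg.hasFDerivAt)]
  simp [hb0]

/-- The partial derivatives of `Z = x + iyb(x)`. -/
theorem pdx_pdy_add_I_mul_mul {b : ℝ → ℝ} {p : ℝ × ℝ} (hb : DifferentiableAt ℝ b p.1) :
    pdx (fun q : ℝ × ℝ => (q.1 : ℂ) + Complex.I * q.2 * (b q.1)) p
        = 1 + Complex.I * p.2 * (deriv b p.1) ∧
      pdy (fun q : ℝ × ℝ => (q.1 : ℂ) + Complex.I * q.2 * (b q.1)) p = Complex.I * b p.1 := by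
  have hx : HasFDerivAt (fun q : ℝ × ℝ => (q.1 : ℂ)) _ p :=
    Complex.ofRealCLM.hasFDerivAt.comp p hasFDerivAt_fst
  have hy : HasFDerivAt (fun q : ℝ × ℝ => (q.2 : ℂ)) _ p :=
    Complex.ofRealCLM.hasFDerivAt.comp p hasFDerivAt_snd
  have hbx : HasFDerivAt (fun q : ℝ × ℝ => (b q.1 : ℂ)) _ p :=
    hb.hasDerivAt.ofReal_comp.hasFDerivAt.comp p hasFDerivAt_fst
  have h : HasFDerivAt (fun q : ℝ × ℝ => (q.1 : ℂ) + Complex.I * q.2 * (b q.1)) _ p :=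
    hx.add ((hy.const_mul Complex.I).mul hbx)
  constructor
  · rw [pdx, h.fderiv]; simp
  · rw [pdy, h.fderiv]; simp; ring

/-- The example of Section 3: a fat Cantor set `K`, a smooth `b ≥ 0` vanishing
exactly on `K`, and the locally integrable vector field `L` with first integral
`Z = x + iyb(x)` for which `u = χ_K` is a bounded solution that does not converge
to its boundary value along any full neighborhood of a vertical segment over `K`. -/
theorem cantor_example :
    ∃ K : Set ℝ, IsCompact K ∧ K ⊆ Ioo (-1) 1 ∧ 0 < volume K ∧
      interior K = ∅ ∧ (∀ x ∈ K, x ∈ closure (K \ {x})) ∧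
    ∃ b : ℝ → ℝ, ContDiffOn ℝ (⊤ : ℕ∞) b (Ioo (-1) 1) ∧
      (∀ x ∈ K, b x = 0) ∧ (∀ x ∈ Ioo (-1) 1 \ K, 0 < b x) ∧
      -- the coefficient `a = -ib(x)/(1+iyb'(x))` and first integral `Z = x+iyb(x)`
      (∀ a : ℝ × ℝ → ℂ,
        (∀ p : ℝ × ℝ, a p = -Complex.I * (b p.1) / (1 + Complex.I * p.2 * (deriv b p.1))) →
        ∀ Z : ℝ × ℝ → ℂ,
        (∀ p : ℝ × ℝ, Z p = p.1 + Complex.I * p.2 * (b p.1)) →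
        ∀ u : ℝ × ℝ → ℂ,
        (∀ p : ℝ × ℝ, u p = if p.1 ∈ K then 1 else 0) →
          -- (i) `Z` is a first integral with `∂_x Z ≠ 0`: `L` is locally integrable
          (∀ p ∈ Ioo (-1 : ℝ) 1 ×ˢ (Set.univ : Set ℝ),
            pdy Z p + a p * pdx Z p = 0 ∧ pdx Z p ≠ 0) ∧
          -- (ii) `u = χ_K` is a bounded distributional solution of `Lu = 0`
          (∃ C : ℝ, ∀ p : ℝ × ℝ, ‖u p‖ ≤ C) ∧
          IsDistribSol a u (Ioo (-1 : ℝ) 1 ×ˢ (Set.univ : Set ℝ)) ∧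
          -- (iii) failure of convergence along full neighborhoods of the segment
          (∀ x₀ ∈ K, (∀ y : ℝ, u (x₀, y) = 1) ∧
            ∀ V : Set (ℝ × ℝ), IsOpen V → {x₀} ×ˢ Ioo (0 : ℝ) 1 ⊆ V →
              ∃ p ∈ V, 0 < p.2 ∧ u p = 0)) := by
  obtain ⟨K, hK, hKs, hKpos, hKint, hKacc⟩ :=
    exists_compact_perfect_nowhere_dense (isOpen_Ioo (a := (-1 : ℝ)) (b := 1)) ⟨0, by simp⟩
  obtain ⟨b, hbsupp, hbs, hbrange⟩ :=
    hK.isClosed.isOpen_compl.exists_contDiff_support_eq (n := (⊤ : ℕ∞))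
  have hbnn (x : ℝ) : 0 ≤ b x := (hbrange (mem_range_self x)).1
  have hb0 (x : ℝ) (hx : x ∈ K) : b x = 0 := by
    rw [← Function.notMem_support, hbsupp]
    exact not_not_intro hx
  have hbdiff : Differentiable ℝ b := hbs.differentiable (by simp)
  have hb'0 (x : ℝ) (hx : x ∈ K) : deriv b x = 0 :=
    IsLocalMin.deriv_eq_zero (Eventually.of_forall fun z => (hb0 x hx).trans_le (hbnn z))
  have hb'diff : Differentiable ℝ (deriv b) :=
    ((contDiff_infty_iff_deriv.1 hbs).2).differentiable (by simp)
  refine ⟨K, hK, hKs, hKpos, hKint, hKacc, b, hbs.contDiffOn, hb0, fun x hx => ?_, ?_⟩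
  · have : x ∈ b.support := hbsupp ▸ hx.2
    exact (hbnn x).lt_of_ne' this
  intro a ha Z hZ u hu
  obtain rfl : a = _ := funext ha
  obtain rfl : Z = _ := funext hZ
  obtain rfl : u = _ := funext hu
  refine ⟨fun p _ => ?_, ⟨1, fun p => ?_⟩, fun ψ hψ hc _ => ?_, fun x₀ hx₀ => ⟨fun y => ?_, ?_⟩⟩
  · obtain ⟨hx, hy⟩ := pdx_pdy_add_I_mul_mul (hbdiff p.1)
    have hne := one_add_I_mul_ofReal_mul_ofReal_ne_zero p.2 (deriv b p.1)
    rw [hx, hy]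
    refine ⟨?_, hne⟩
    rw [div_mul_cancel₀ _ hne]
    ring
  · rw [hu]
    split_ifs <;> simp
  · have hmeas : MeasurableSet (K ×ˢ (univ : Set ℝ)) := hK.measurableSet.prod .univ
    have key (p : ℝ × ℝ) : (if p.1 ∈ K then (1 : ℂ) else 0) * (pdy ψ p + pdx (fun q =>
        -Complex.I * (b q.1) / (1 + Complex.I * q.2 * (deriv b q.1)) * ψ q) p)
          = (K ×ˢ (univ : Set ℝ)).indicator (pdy ψ) p := by
      by_cases hp : p.1 ∈ K
      · have hg : DifferentiableAt ℝ (fun q : ℝ × ℝ =>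
            -Complex.I * ψ q / (1 + Complex.I * q.2 * (deriv b q.1))) p := by
          have h1 : DifferentiableAt ℝ (fun q : ℝ × ℝ => (q.2 : ℂ)) p :=
            Complex.ofRealCLM.differentiableAt.comp p differentiableAt_snd
          have h2 : DifferentiableAt ℝ (fun q : ℝ × ℝ => ((deriv b q.1 : ℝ) : ℂ)) p :=
            Complex.ofRealCLM.differentiableAt.comp p
              ((hb'diff p.1).comp p differentiableAt_fst)
          have h3 : DifferentiableAt ℝ ψ p := hψ.differentiable (by simp) p
          have h4 := one_add_I_mul_ofReal_mul_ofReal_ne_zero p.2 (deriv b p.1)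
          simp only [div_eq_mul_inv]
          exact (h3.const_mul _).mul
            (DifferentiableAt.inv (((h1.const_mul _).mul h2).const_add _) h4)
        have h0 := pdx_ofReal_comp_fst_mul_eq_zero
          (hb'0 p.1 hp ▸ (hbdiff p.1).hasDerivAt) (hb0 p.1 hp) hg
        have heq : (fun q : ℝ × ℝ =>
            -Complex.I * (b q.1) / (1 + Complex.I * q.2 * (deriv b q.1)) * ψ q) = fun q =>
              (b q.1 : ℂ) * (-Complex.I * ψ q / (1 + Complex.I * q.2 * (deriv b q.1))) := by
          funext q
          ring
        rw [heq, h0, indicator_of_mem (by simpa using hp), if_pos hp, add_zero, one_mul]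
      · rw [indicator_of_notMem (by simpa using hp), if_neg hp, zero_mul]
    simp_rw [key]
    rw [setIntegral_indicator hmeas, inter_eq_right.2 (prod_mono hKs subset_rfl)]
    exact setIntegral_prod_univ_pdy_eq_zero hψ hc K
  · exact if_pos hx₀
  · intro V hV hsub
    have hmem : (x₀, (1 / 2 : ℝ)) ∈ V := hsub ⟨rfl, by norm_num, by norm_num⟩
    have hopen : IsOpen ((fun x : ℝ => (x, (1 / 2 : ℝ))) ⁻¹' V) :=
      hV.preimage (by fun_prop)
    obtain ⟨x, hxV, hxK⟩ :=
      (interior_eq_empty_iff_dense_compl.1 hKint).inter_open_nonempty _ hopen ⟨x₀, hmem⟩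
    exact ⟨(x, 1 / 2), hxV, by norm_num, if_neg hxK⟩
end

section
/- Let φ : ℝ² → ℝ be smooth on a neighborhood of [−a₀,a₀]×[0,b₀], let L = ∂/∂y − (iφ_y/(1+iφ_x))∂/∂x, and let u be a bounded measurable function on (−a₀,a₀)×(0,b₀) with Lu = 0 in the sense of distributions. Let F = {x ∈ (−a₀,a₀) : φ(x,y) = φ(x,0) for all y ∈ [0,b₀]} (the set of x where y ↦ φ(x,y) is constant). Then there exists δ > 0 such that for almost every x ∈ F ∩ (−δ,δ) there is a constant c(x) ∈ ℂ with u(x,y) = c(x) for almost every y ∈ (0,δ); that is, on almost every constant fiber of the first integral, the solution u is essentially constant in y. -/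
open MeasureTheory Set Filter Topology Complex

/-- Partial derivative in the `x` direction (real-valued functions). -/
noncomputable def pdxR (f : ℝ × ℝ → ℝ) (p : ℝ × ℝ) : ℝ := fderiv ℝ f p (1, 0)

/-- Partial derivative in the `y` direction (real-valued functions). -/
noncomputable def pdyR (f : ℝ × ℝ → ℝ) (p : ℝ × ℝ) : ℝ := fderiv ℝ f p (0, 1)

/-- The coefficient `a = -iφ_y/(1+iφ_x)` of the vector field in adapted
coordinates, for which `Z = x + iφ` is a first integral. -/
noncomputable def coeffA (φ : ℝ × ℝ → ℝ) (p : ℝ × ℝ) : ℂ :=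
  -Complex.I * (pdyR φ p) / (1 + Complex.I * (pdxR φ p))

/-- A smooth real function with compact support contained in the interval `(α, β)`. -/
def IsTestOn (α β : ℝ) (g : ℝ → ℝ) : Prop :=
  ContDiff ℝ (⊤ : ℕ∞) g ∧ HasCompactSupport g ∧ tsupport g ⊆ Ioo α β

namespace IsTestOn

variable {α β : ℝ} {g h : ℝ → ℝ}

lemma eq_zero (hg : IsTestOn α β g) {x : ℝ} (hx : x ∉ Ioo α β) : g x = 0 :=
  image_eq_zero_of_notMem_tsupport fun h => hx (hg.2.2 h)

lemma contDiff_deriv (hg : IsTestOn α β g) : ContDiff ℝ (⊤ : ℕ∞) (deriv g) :=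
  (contDiff_infty_iff_deriv.1 hg.1).2

lemma exists_bound (hg : IsTestOn α β g) : ∃ C, ∀ x, ‖g x‖ ≤ C :=
  hg.1.continuous.bounded_above_of_compact_support hg.2.1

lemma deriv (hg : IsTestOn α β g) : IsTestOn α β (deriv g) :=
  ⟨hg.contDiff_deriv, hg.2.1.deriv, tsupport_deriv_subset.trans hg.2.2⟩

lemma sub_const_mul (hg : IsTestOn α β g) (hh : IsTestOn α β h) (c : ℝ) :
    IsTestOn α β (fun x => g x - c * h x) := by
  have hc : IsTestOn α β (fun x => c * h x) :=
    ⟨contDiff_const.mul hh.1, hh.2.1.mul_left, (tsupport_mul_subset_right).trans hh.2.2⟩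
  exact ⟨hg.1.sub hc.1, hg.2.1.sub hc.2.1,
    (tsupport_sub g (fun x => c * h x)).trans (union_subset hg.2.2 hc.2.2)⟩

/-- A test function with vanishing integral is the derivative of a test function. -/
lemma exists_primitive (hαβ : α < β) (hg : IsTestOn α β g) (hint : ∫ x, g x = 0) :
    ∃ G, IsTestOn α β G ∧ _root_.deriv G = g := by
  have hcont : Continuous g := hg.1.continuous
  obtain ⟨s, t, hst, hsub, hsupp⟩ :
      ∃ s t, s ≤ t ∧ Icc s t ⊆ Ioo α β ∧ tsupport g ⊆ Icc s t := by
    rcases (tsupport g).eq_empty_or_nonempty with he | hne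
    · refine ⟨(α + β) / 2, (α + β) / 2, le_rfl, fun x hx => ?_, by simp [he]⟩
      constructor <;> linarith [hx.1, hx.2]
    · have hK : IsCompact (tsupport g) := hg.2.1
      refine ⟨sInf (tsupport g), sSup (tsupport g), ?_, ?_, fun x hx =>
        ⟨csInf_le hK.bddBelow hx, le_csSup hK.bddAbove hx⟩⟩
      · exact csInf_le_csSup hne hK.bddBelow hK.bddAbove
      · exact fun x hx => ⟨(hg.2.2 (hK.sInf_mem hne)).1.trans_le hx.1,
          hx.2.trans_lt (hg.2.2 (hK.sSup_mem hne)).2⟩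
  have hzero : ∀ x, x ∉ Icc s t → g x = 0 := fun x hx =>
    image_eq_zero_of_notMem_tsupport fun h => hx (hsupp h)
  have hder : ∀ x, HasDerivAt (fun x => ∫ y in s..x, g y) (g x) x := fun x =>
    intervalIntegral.integral_hasDerivAt_right (hcont.intervalIntegrable _ _)
      hcont.aestronglyMeasurable.stronglyMeasurableAtFilter hcont.continuousAt
  have hdeq : _root_.deriv (fun x => ∫ y in s..x, g y) = g := funext fun x => (hder x).deriv
  have hout : ∀ x, x ∉ Icc s t → ∫ y in s..x, g y = 0 := by
    intro x hx
    rcases lt_or_ge x s with hxs | hxs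
    · rw [intervalIntegral.integral_symm, intervalIntegral.integral_of_le hxs.le, neg_eq_zero,
        integral_Ioc_eq_integral_Ioo]
      exact setIntegral_eq_zero_of_forall_eq_zero fun y hy => hzero y fun h => by
        linarith [hy.2, h.1]
    · have hxt : t < x := by
        by_contra hc
        exact hx ⟨hxs, not_lt.1 hc⟩
      rw [intervalIntegral.integral_of_le hxs, ← integral_Icc_eq_integral_Ioc,
        setIntegral_eq_integral_of_forall_compl_eq_zero, hint]
      exact fun y hy => hzero y fun h => hy ⟨h.1, h.2.trans hxt.le⟩
  have hts : tsupport (fun x => ∫ y in s..x, g y) ⊆ Icc s t :=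
    closure_minimal (fun x hx => by
      by_contra hc
      exact hx (hout x hc)) isClosed_Icc
  refine ⟨_, ⟨?_, ?_, hts.trans hsub⟩, hdeq⟩
  · exact contDiff_infty_iff_deriv.2 ⟨fun x => (hder x).differentiableAt, by rw [hdeq]; exact hg.1⟩
  · exact isCompact_Icc.of_isClosed_subset (isClosed_tsupport _) hts

lemma exists_integral_eq_one (hαβ : α < β) : ∃ g, IsTestOn α β g ∧ ∫ x, g x = 1 := by
  let b : ContDiffBump ((α + β) / 2) := ⟨(β - α) / 8, (β - α) / 4, by linarith, by linarith⟩
  refine ⟨b.normed volume, ⟨b.contDiff_normed, b.hasCompactSupport_normed, ?_⟩, b.integral_normed⟩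
  rw [b.tsupport_normed_eq, Real.closedBall_eq_Icc]
  intro x hx
  change _ ∈ Icc (_ - (β - α) / 4) (_ + (β - α) / 4) at hx
  constructor <;> linarith [hx.1, hx.2]

lemma integrableOn_mul (hg : IsTestOn α β g) {f : ℝ → ℝ} {s : Set ℝ} (hf : IntegrableOn f s) :
    IntegrableOn (fun x => g x * f x) s := by
  obtain ⟨C, hC⟩ := hg.exists_bound
  exact Integrable.bdd_mul hf hg.1.continuous.aestronglyMeasurable (Eventually.of_forall hC)

lemma setIntegral_mul (hg : IsTestOn α β g) (f : ℝ → ℝ) :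
    ∫ x in Ioo α β, g x * f x = ∫ x, g x * f x :=
  setIntegral_eq_integral_of_forall_compl_eq_zero fun _ hx => by simp [hg.eq_zero hx]

lemma setIntegral_eq (hg : IsTestOn α β g) : ∫ x in Ioo α β, g x = ∫ x, g x :=
  setIntegral_eq_integral_of_forall_compl_eq_zero fun _ hx => hg.eq_zero hx

end IsTestOn

/-- The lemma of du Bois-Reymond. -/
lemma ae_eq_const_of_forall_integral_deriv_mul_eq_zero {α β : ℝ} (hαβ : α < β) {f : ℝ → ℝ}
    (hf : IntegrableOn f (Ioo α β))
    (h : ∀ g, IsTestOn α β g → ∫ x in Ioo α β, deriv g x * f x = 0) :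
    ∃ c, ∀ᵐ x, x ∈ Ioo α β → f x = c := by
  obtain ⟨g₀, hg₀, hg₀1⟩ := IsTestOn.exists_integral_eq_one hαβ
  refine ⟨∫ x in Ioo α β, g₀ x * f x, ?_⟩
  set c := ∫ x in Ioo α β, g₀ x * f x with hc
  have hfc : IntegrableOn (fun x => f x - c) (Ioo α β) := hf.sub (integrableOn_const (by simp))
  have key := isOpen_Ioo.ae_eq_zero_of_integral_contDiff_smul_eq_zero (μ := volume)
    (U := Ioo α β) (f := fun x => f x - c) hfc.locallyIntegrableOn ?_
  · filter_upwards [key] with x hx hxm using sub_eq_zero.1 (hx hxm)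
  intro g hg1 hg2 hg3
  have hg : IsTestOn α β g := ⟨hg1, hg2, hg3⟩
  have hgi : Integrable g := hg1.continuous.integrable_of_hasCompactSupport hg2
  have hg₀i : Integrable g₀ := hg₀.1.continuous.integrable_of_hasCompactSupport hg₀.2.1
  obtain ⟨G, hG, hGd⟩ := (hg.sub_const_mul hg₀ (∫ x, g x)).exists_primitive hαβ (by
    rw [integral_sub hgi (hg₀i.const_mul _), integral_const_mul, hg₀1, mul_one, sub_self])
  have h1 := h G hG
  rw [hGd] at h1
  have h2 : ∫ x in Ioo α β, (g x - (∫ x, g x) * g₀ x) * f x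
      = (∫ x in Ioo α β, g x * f x) - (∫ x, g x) * c := by
    rw [hc, ← integral_const_mul, ← integral_sub (hg.integrableOn_mul hf)
      ((hg₀.integrableOn_mul hf).const_mul _)]
    congr 1 with x
    ring
  simp only [smul_eq_mul]
  rw [← hg.setIntegral_mul]
  simp only [mul_sub]
  rw [integral_sub (hg.integrableOn_mul hf) (hgi.integrableOn.mul_const _), integral_mul_const,
    hg.setIntegral_eq]
  linarith

/-- Almost every point of a set of reals is an accumulation point of that set. -/
lemma ae_uniqueDiffWithinAt (s : Set ℝ) : ∀ᵐ x, x ∈ s → UniqueDiffWithinAt ℝ s x := by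
  have hc := (countable_setOfPred_isolated_right_within (s := s)).ae_notMem volume
  filter_upwards [hc] with x hx hxs
  have hne : (𝓝[s ∩ Ioi x] x).NeBot := ⟨fun h => hx ⟨hxs, h⟩⟩
  refine AccPt.uniqueDiffWithinAt ?_
  rw [accPt_principal_iff_nhdsWithin]
  exact hne.mono (nhdsWithin_mono _ fun y hy => ⟨hy.1, ne_of_gt hy.2⟩)

/-- If `k` has weak derivative `m`, then `m` vanishes almost everywhere on the zero set of `k`. -/
lemma ae_eq_zero_of_weak_deriv_of_eq_zero {α β : ℝ} (hαβ : α < β) {k m : ℝ → ℝ}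
    (hk : IntegrableOn k (Ioo α β)) (hm : IntegrableOn m (Ioo α β))
    (h : ∀ g, IsTestOn α β g → ∫ x in Ioo α β, (g x * m x + deriv g x * k x) = 0)
    {s : Set ℝ} (hs : s ⊆ Ioo α β) (hks : ∀ x ∈ s, k x = 0) :
    ∀ᵐ x, x ∈ s → m x = 0 := by
  have hmi : IntervalIntegrable m volume α β := by
    rwa [intervalIntegrable_iff_integrableOn_Ioo_of_le hαβ.le]
  set K : ℝ → ℝ := fun x => ∫ t in α..x, m t with hK
  have hKac : AbsolutelyContinuousOnInterval K α β :=
    hmi.absolutelyContinuousOnInterval_intervalIntegral left_mem_uIcc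
  have hKd : ∀ᵐ x, x ∈ Ioo α β → HasDerivAt K (m x) x := by
    filter_upwards [hmi.ae_hasDerivAt_integral] with x hx hxm
    exact hx (by rw [uIcc_of_le hαβ.le]; exact Ioo_subset_Icc_self hxm) α left_mem_uIcc
  have hKi : IntegrableOn K (Ioo α β) := by
    have := hKac.continuousOn.integrableOn_compact (μ := volume) isCompact_uIcc
    rw [uIcc_of_le hαβ.le] at this
    exact this.mono_set Ioo_subset_Icc_self
  obtain ⟨c, hc⟩ := ae_eq_const_of_forall_integral_deriv_mul_eq_zero hαβ
    (f := fun x => k x - K x) (hk.sub hKi) (by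
      intro g hg
      have hgac : AbsolutelyContinuousOnInterval g α β :=
        (hg.1.of_le (by simp)).contDiffOn.absolutelyContinuousOnInterval
      have h1 := hKac.integral_mul_deriv_eq_deriv_mul hgac
      rw [hg.eq_zero (x := α) (by simp), hg.eq_zero (x := β) (by simp),
        intervalIntegral.integral_of_le hαβ.le, intervalIntegral.integral_of_le hαβ.le,
        integral_Ioc_eq_integral_Ioo, integral_Ioc_eq_integral_Ioo] at h1
      have h2 : ∫ x in Ioo α β, deriv K x * g x = ∫ x in Ioo α β, g x * m x :=
        setIntegral_congr_ae measurableSet_Ioo (by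
          filter_upwards [hKd] with x hx hxm
          rw [(hx hxm).deriv, mul_comm])
      have h3 : ∫ x in Ioo α β, K x * deriv g x = ∫ x in Ioo α β, deriv g x * K x := by
        simp only [mul_comm]
      have h4 := h g hg
      rw [integral_add (hg.integrableOn_mul hm) (hg.deriv.integrableOn_mul hk)] at h4
      simp only [mul_sub]
      rw [integral_sub (hg.deriv.integrableOn_mul hk) (hg.deriv.integrableOn_mul hKi)]
      linarith)
  filter_upwards [hc, hKd, ae_uniqueDiffWithinAt {x | x ∈ s ∧ K x = -c}] with x hx hxd hxu hxs
  have hkey : ∀ y ∈ {x | x ∈ s ∧ K x = -c}, K y = -c := fun y hy => hy.2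
  have hKx : K x = -c := by linarith [hx (hs hxs), hks x hxs]
  have hd : HasDerivWithinAt K (m x) {x | x ∈ s ∧ K x = -c} x := (hxd (hs hxs)).hasDerivWithinAt
  exact (hxu ⟨hxs, hKx⟩).eq_deriv _ hd ((hasDerivWithinAt_const x _ (-c)).congr hkey hKx)

/-- Countably many test functions suffice in the lemma of du Bois-Reymond. -/
lemma exists_countable_isTestOn_du_bois_reymond {α β : ℝ} (hαβ : α < β) :
    ∃ D : Set (ℝ → ℝ), D.Countable ∧ (∀ η ∈ D, IsTestOn α β η) ∧
      ∀ f : ℝ → ℝ, IntegrableOn f (Ioo α β) →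
        (∀ η ∈ D, ∫ y in Ioo α β, deriv η y * f y = 0) →
        ∃ c, ∀ᵐ y, y ∈ Ioo α β → f y = c := by
  let T : Set C(Icc α β, ℝ) := {F | ∃ η, IsTestOn α β η ∧ ∀ y : Icc α β, F y = deriv η y}
  obtain ⟨t, htT, htc, htd⟩ :=
    (TopologicalSpace.IsSeparable.of_separableSpace T).exists_countable_dense_subset
  choose! e he using fun F (hF : F ∈ t) => htT hF
  refine ⟨e '' t, htc.image e, ?_, fun f hf h0 => ?_⟩
  · rintro _ ⟨F, hF, rfl⟩
    exact (he F hF).1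
  refine ae_eq_const_of_forall_integral_deriv_mul_eq_zero hαβ hf fun g hg => ?_
  let F₀ : C(Icc α β, ℝ) := ⟨fun y => deriv g y, hg.deriv.1.continuous.comp continuous_subtype_val⟩
  have hF₀ : F₀ ∈ closure t := htd ⟨g, hg, fun _ => rfl⟩
  set A := ∫ y in Ioo α β, ‖f y‖ with hA
  have hA0 : 0 ≤ A := integral_nonneg fun _ => norm_nonneg _
  have hle : ∀ ε > 0, ‖∫ y in Ioo α β, deriv g y * f y‖ ≤ ε * A := by
    intro ε hε
    obtain ⟨F, hF, hdist⟩ := Metric.mem_closure_iff.1 hF₀ ε hε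
    have hFe := h0 (e F) ⟨F, hF, rfl⟩
    have hT := (he F hF).1
    rw [← sub_zero (∫ y in Ioo α β, deriv g y * f y), ← hFe,
      ← integral_sub (hg.deriv.integrableOn_mul hf) (hT.deriv.integrableOn_mul hf), hA,
      ← integral_const_mul]
    refine norm_integral_le_of_norm_le (hf.norm.const_mul ε) ?_
    refine ae_restrict_of_forall_mem measurableSet_Ioo fun y hy => ?_
    have hy' : y ∈ Icc α β := Ioo_subset_Icc_self hy
    rw [← sub_mul, norm_mul]
    gcongr
    have h1 := (ContinuousMap.dist_apply_le_dist (f := F₀) (g := F) ⟨y, hy'⟩).trans hdist.le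
    rw [(he F hF).2 ⟨y, hy'⟩, dist_eq_norm] at h1
    exact h1
  refine norm_le_zero_iff.1 (le_of_forall_pos_le_add fun ε hε => ?_)
  have h1 := hle (ε / (A + 1)) (by positivity)
  refine h1.trans ?_
  rw [zero_add, div_mul_eq_mul_div, div_le_iff₀ (by positivity)]
  nlinarith

lemma contDiffAt_coeffA {φ : ℝ × ℝ → ℝ} {p : ℝ × ℝ} (hφ : ContDiffAt ℝ (⊤ : ℕ∞) φ p) :
    ContDiffAt ℝ (⊤ : ℕ∞) (coeffA φ) p := by
  have hd : ContDiffAt ℝ (⊤ : ℕ∞) (fderiv ℝ φ) p := hφ.fderiv_right (by simp)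
  have hx : ContDiffAt ℝ (⊤ : ℕ∞) (fun q => ((pdxR φ q : ℝ) : ℂ)) p :=
    ofRealCLM.contDiff.contDiffAt.comp p (hd.clm_apply contDiffAt_const)
  have hy : ContDiffAt ℝ (⊤ : ℕ∞) (fun q => ((pdyR φ q : ℝ) : ℂ)) p :=
    ofRealCLM.contDiff.contDiffAt.comp p (hd.clm_apply contDiffAt_const)
  have hne : (1 : ℂ) + I * (pdxR φ p : ℂ) ≠ 0 := fun h => by
    simpa using congrArg re h
  have hden : ContDiffAt ℝ (⊤ : ℕ∞) (fun q => (1 : ℂ) + I * (pdxR φ q : ℂ)) p :=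
    contDiffAt_const.add (contDiffAt_const.mul hx)
  have h := (contDiffAt_const (c := -I)).mul hy |>.mul (hden.inv hne)
  simpa only [← div_eq_mul_inv] using! h

lemma hasDerivAt_slice_fst {f : ℝ × ℝ → ℂ} {x y : ℝ} (hf : DifferentiableAt ℝ f (x, y)) :
    HasDerivAt (fun t => f (t, y)) (pdx f (x, y)) x :=
  hf.hasFDerivAt.comp_hasDerivAt x ((hasDerivAt_id x).prodMk (hasDerivAt_const x y))

lemma hasDerivAt_slice_snd {f : ℝ × ℝ → ℝ} {x y : ℝ} (hf : DifferentiableAt ℝ f (x, y)) :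
    HasDerivAt (fun t => f (x, t)) (pdyR f (x, y)) y :=
  hf.hasFDerivAt.comp_hasDerivAt y ((hasDerivAt_const y x).prodMk (hasDerivAt_id y))

lemma coeffA_eq_zero_of_eq_const {φ : ℝ × ℝ → ℝ} {b x y : ℝ}
    (hφ : DifferentiableAt ℝ φ (x, y)) (hy : y ∈ Ioo 0 b)
    (hF : ∀ t ∈ Icc (0 : ℝ) b, φ (x, t) = φ (x, 0)) : coeffA φ (x, y) = 0 := by
  have h0 : HasDerivAt (fun t => φ (x, t)) 0 y :=
    (hasDerivAt_const y (φ (x, 0))).congr_of_eventuallyEq (by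
      filter_upwards [isOpen_Ioo.mem_nhds hy] with t ht using hF t (Ioo_subset_Icc_self ht))
  simp [coeffA, (hasDerivAt_slice_snd hφ).unique h0]

/-- A tensor product of test functions, viewed as a complex function on the plane. -/
def tensorTest (g η : ℝ → ℝ) (p : ℝ × ℝ) : ℂ := ((g p.1 * η p.2 : ℝ) : ℂ)

lemma contDiff_tensorTest {a b c d : ℝ} {g η : ℝ → ℝ} (hg : IsTestOn a b g)
    (hη : IsTestOn c d η) : ContDiff ℝ (⊤ : ℕ∞) (tensorTest g η) :=
  ofRealCLM.contDiff.comp ((hg.1.comp contDiff_fst).mul (hη.1.comp contDiff_snd))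

lemma tsupport_tensorTest_subset (g η : ℝ → ℝ) :
    tsupport (tensorTest g η) ⊆ tsupport g ×ˢ tsupport η := by
  refine closure_minimal (fun p hp => ?_) ((isClosed_tsupport g).prod (isClosed_tsupport η))
  have hp' : g p.1 * η p.2 ≠ 0 := fun h => hp (by simp [tensorTest, h])
  exact ⟨subset_tsupport g (left_ne_zero_of_mul hp'), subset_tsupport η (right_ne_zero_of_mul hp')⟩

lemma hasCompactSupport_tensorTest {a b c d : ℝ} {g η : ℝ → ℝ} (hg : IsTestOn a b g)
    (hη : IsTestOn c d η) : HasCompactSupport (tensorTest g η) :=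
  (hg.2.1.isCompact.prod hη.2.1.isCompact).of_isClosed_subset (isClosed_tsupport _)
    (tsupport_tensorTest_subset g η)

lemma pdx_pdy_tensorTest {a b c d : ℝ} {g η : ℝ → ℝ} (hg : IsTestOn a b g)
    (hη : IsTestOn c d η) (x y : ℝ) :
    pdx (tensorTest g η) (x, y) = ((deriv g x * η y : ℝ) : ℂ) ∧
      pdy (tensorTest g η) (x, y) = ((g x * deriv η y : ℝ) : ℂ) := by
  have hd : DifferentiableAt ℝ (tensorTest g η) (x, y) :=
    (contDiff_tensorTest hg hη).differentiable (by simp) _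
  constructor
  · refine (hasDerivAt_slice_fst hd).unique ?_
    exact ((hg.1.differentiable (by simp) x).hasDerivAt.mul_const (η y)).ofReal_comp
  · have h1 : HasDerivAt (fun t => tensorTest g η (x, t)) (pdy (tensorTest g η) (x, y)) y :=
      hd.hasFDerivAt.comp_hasDerivAt y ((hasDerivAt_const y x).prodMk (hasDerivAt_id y))
    exact h1.unique
      ((hη.1.differentiable (by simp) y).hasDerivAt.const_mul (g x)).ofReal_comp

lemma pdx_mul {f h : ℝ × ℝ → ℂ} {p : ℝ × ℝ} (hf : DifferentiableAt ℝ f p)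
    (hh : DifferentiableAt ℝ h p) : pdx (fun q => f q * h q) p = f p * pdx h p + pdx f p * h p := by
  simp [pdx, fderiv_fun_mul hf hh, mul_comm]

/-- If `k` is the complex-valued weak antiderivative of `m`, then `m` vanishes almost everywhere
on the zero set of `k`. -/
lemma ae_eq_zero_of_weak_deriv_of_eq_zero_complex {α β : ℝ} (hαβ : α < β) {k m : ℝ → ℂ}
    (hk : IntegrableOn k (Ioo α β)) (hm : IntegrableOn m (Ioo α β))
    (h : ∀ g, IsTestOn α β g → ∫ x in Ioo α β, ((g x : ℂ) * m x + ((deriv g x : ℝ) : ℂ) * k x) = 0)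
    {s : Set ℝ} (hs : s ⊆ Ioo α β) (hks : ∀ x ∈ s, k x = 0) :
    ∀ᵐ x, x ∈ s → m x = 0 := by
  have hint : ∀ g, IsTestOn α β g →
      IntegrableOn (fun x => (g x : ℂ) * m x + ((deriv g x : ℝ) : ℂ) * k x) (Ioo α β) := by
    intro g hg
    obtain ⟨C, hC⟩ := hg.exists_bound
    obtain ⟨C', hC'⟩ := hg.deriv.exists_bound
    exact (Integrable.bdd_mul hm (continuous_ofReal.comp hg.1.continuous).aestronglyMeasurable
      (Eventually.of_forall fun x => by simpa using hC x)).add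
      (Integrable.bdd_mul hk (continuous_ofReal.comp hg.deriv.1.continuous).aestronglyMeasurable
      (Eventually.of_forall fun x => by simpa using hC' x))
  have hre := ae_eq_zero_of_weak_deriv_of_eq_zero hαβ (k := fun x => (k x).re)
    (m := fun x => (m x).re) hk.re hm.re (fun g hg => by
      have h1 := congrArg re (h g hg)
      rw [← reCLM_apply, ← reCLM.integral_comp_comm (hint g hg)] at h1
      simpa using h1) hs (fun x hx => by simp [hks x hx])
  have him := ae_eq_zero_of_weak_deriv_of_eq_zero hαβ (k := fun x => (k x).im)
    (m := fun x => (m x).im) hk.im hm.im (fun g hg => by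
      have h1 := congrArg im (h g hg)
      rw [← imCLM_apply, ← imCLM.integral_comp_comm (hint g hg)] at h1
      simpa using h1) hs (fun x hx => by simp [hks x hx])
  filter_upwards [hre, him] with x h1 h2 hx using Complex.ext (h1 hx) (h2 hx)

/-- Fubini for the pairing of a function on a rectangle with a function of the first variable. -/
lemma setIntegral_prod_fst_mul {s t : Set ℝ} {P : ℝ × ℝ → ℂ} (hP : IntegrableOn P (s ×ˢ t))
    {g : ℝ → ℝ} (hg : Continuous g) {C : ℝ} (hC : ∀ x, ‖g x‖ ≤ C) :
    IntegrableOn (fun p => (g p.1 : ℂ) * P p) (s ×ˢ t) ∧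
      ∫ p in s ×ˢ t, (g p.1 : ℂ) * P p = ∫ x in s, (g x : ℂ) * ∫ y in t, P (x, y) := by
  have hi : IntegrableOn (fun p => (g p.1 : ℂ) * P p) (s ×ˢ t) :=
    Integrable.bdd_mul hP (continuous_ofReal.comp (hg.comp continuous_fst)).aestronglyMeasurable
      (Eventually.of_forall fun p => by simpa using hC p.1)
  refine ⟨hi, ?_⟩
  rw [Measure.volume_eq_prod] at hi ⊢
  rw [setIntegral_prod _ hi]
  simp only [integral_const_mul]

lemma integrableOn_integral_snd {s t : Set ℝ} {P : ℝ × ℝ → ℂ} (hP : IntegrableOn P (s ×ˢ t)) :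
    IntegrableOn (fun x => ∫ y in t, P (x, y)) s := by
  rw [IntegrableOn, Measure.volume_eq_prod, ← Measure.prod_restrict] at hP
  exact hP.integral_prod_left

/-- For a fixed test function `η` in `y`, almost every constant fiber annihilates `η'`. -/
lemma ae_integral_mul_deriv_eq_zero
    {a₀ b₀ : ℝ} (ha₀ : 0 < a₀) {φ : ℝ × ℝ → ℝ} {V : Set (ℝ × ℝ)} (hV : IsOpen V)
    (hRV : Icc (-a₀) a₀ ×ˢ Icc 0 b₀ ⊆ V) (hφ : ContDiffOn ℝ (⊤ : ℕ∞) φ V)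
    {u : ℝ × ℝ → ℂ} (hu_meas : Measurable u)
    {C : ℝ} (hu_bdd : ∀ p ∈ Ioo (-a₀) a₀ ×ˢ Ioo 0 b₀, ‖u p‖ ≤ C)
    (hsol : IsDistribSol (coeffA φ) u (Ioo (-a₀) a₀ ×ˢ Ioo 0 b₀))
    {η : ℝ → ℝ} (hη : IsTestOn 0 b₀ η) :
    ∀ᵐ x, x ∈ {x ∈ Ioo (-a₀) a₀ | ∀ y ∈ Icc (0 : ℝ) b₀, φ (x, y) = φ (x, 0)} →
      ∫ y in Ioo 0 b₀, ((deriv η y : ℝ) : ℂ) * u (x, y) = 0 := by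
  set R : Set (ℝ × ℝ) := Icc (-a₀) a₀ ×ˢ Icc 0 b₀ with hR
  set Ω : Set (ℝ × ℝ) := Ioo (-a₀) a₀ ×ˢ Ioo 0 b₀ with hΩ
  have hΩR : Ω ⊆ R := prod_mono Ioo_subset_Icc_self Ioo_subset_Icc_self
  have hΩm : MeasurableSet Ω := measurableSet_Ioo.prod measurableSet_Ioo
  have hRc : IsCompact R := isCompact_Icc.prod isCompact_Icc
  have hφV : ∀ p ∈ V, ContDiffAt ℝ (⊤ : ℕ∞) φ p := fun p hp => hφ.contDiffAt (hV.mem_nhds hp)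
  have hAV : ∀ p ∈ V, ContDiffAt ℝ (⊤ : ℕ∞) (coeffA φ) p := fun p hp =>
    contDiffAt_coeffA (hφV p hp)
  have hAd : ∀ p ∈ Ω, DifferentiableAt ℝ (coeffA φ) p := fun p hp =>
    (hAV p (hRV (hΩR hp))).differentiableAt (by simp)
  have hAc : ContinuousOn (coeffA φ) R := fun p hp =>
    (hAV p (hRV hp)).continuousAt.continuousWithinAt
  have hAxc : ContinuousOn (pdx (coeffA φ)) R := fun p hp => by
    have h1 : ContDiffAt ℝ (⊤ : ℕ∞) (fderiv ℝ (coeffA φ)) p :=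
      (hAV p (hRV hp)).fderiv_right (by simp)
    exact (h1.continuousAt.clm_apply continuousAt_const).continuousWithinAt
  have hηc : Continuous fun p : ℝ × ℝ => ((η p.2 : ℝ) : ℂ) :=
    continuous_ofReal.comp (hη.1.continuous.comp continuous_snd)
  have hη'c : Continuous fun p : ℝ × ℝ => ((deriv η p.2 : ℝ) : ℂ) :=
    continuous_ofReal.comp (hη.deriv.1.continuous.comp continuous_snd)
  have humul : ∀ f : ℝ × ℝ → ℂ, ContinuousOn f R → IntegrableOn (fun p => u p * f p) Ω :=
    fun f hf => Integrable.bdd_mul ((hf.integrableOn_compact hRc).mono_set hΩR)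
      hu_meas.aestronglyMeasurable (ae_restrict_of_forall_mem hΩm hu_bdd)
  set P : ℝ × ℝ → ℂ := fun p =>
    u p * ((deriv η p.2 : ℝ) + pdx (coeffA φ) p * (η p.2 : ℝ)) with hPdef
  set Q : ℝ × ℝ → ℂ := fun p => u p * (coeffA φ p * (η p.2 : ℝ)) with hQdef
  have hP : IntegrableOn P Ω :=
    humul _ (hη'c.continuousOn.add (hAxc.mul hηc.continuousOn))
  have hQ : IntegrableOn Q Ω := humul _ (hAc.mul hηc.continuousOn)
  have hA0 : ∀ x ∈ {x ∈ Ioo (-a₀) a₀ | ∀ y ∈ Icc (0 : ℝ) b₀, φ (x, y) = φ (x, 0)},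
      ∀ y ∈ Ioo 0 b₀, coeffA φ (x, y) = 0 := fun x hx y hy =>
    coeffA_eq_zero_of_eq_const ((hφV _ (hRV (hΩR ⟨hx.1, hy⟩))).differentiableAt (by simp)) hy hx.2
  have hm0 := ae_eq_zero_of_weak_deriv_of_eq_zero_complex (by linarith : -a₀ < a₀)
    (integrableOn_integral_snd hQ) (integrableOn_integral_snd hP) (fun g hg => by
      obtain ⟨D, hD⟩ := hg.exists_bound
      obtain ⟨D', hD'⟩ := hg.deriv.exists_bound
      obtain ⟨hi1, h1⟩ := setIntegral_prod_fst_mul hP hg.1.continuous hD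
      obtain ⟨hi2, h2⟩ := setIntegral_prod_fst_mul hQ hg.deriv.1.continuous hD'
      have hj1 : IntegrableOn (fun x => (g x : ℂ) * ∫ y in Ioo 0 b₀, P (x, y)) (Ioo (-a₀) a₀) :=
        Integrable.bdd_mul (integrableOn_integral_snd hP)
          (continuous_ofReal.comp hg.1.continuous).aestronglyMeasurable
          (Eventually.of_forall fun x => by simpa using hD x)
      have hj2 : IntegrableOn (fun x => ((deriv g x : ℝ) : ℂ) * ∫ y in Ioo 0 b₀, Q (x, y))
          (Ioo (-a₀) a₀) :=
        Integrable.bdd_mul (integrableOn_integral_snd hQ)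
          (continuous_ofReal.comp hg.deriv.1.continuous).aestronglyMeasurable
          (Eventually.of_forall fun x => by simpa using hD' x)
      have h3 := hsol (tensorTest g η) (contDiff_tensorTest hg hη)
        (hasCompactSupport_tensorTest hg hη)
        ((tsupport_tensorTest_subset g η).trans (prod_mono hg.2.2 hη.2.2))
      rw [integral_add hj1 hj2, ← h1, ← h2, ← integral_add hi1 hi2, ← h3]
      refine setIntegral_congr_fun hΩm fun p hp => ?_
      obtain ⟨x, y⟩ := p
      obtain ⟨hx, hy⟩ := pdx_pdy_tensorTest hg hη x y
      simp only [hPdef, hQdef]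
      rw [pdx_mul (hAd _ hp) ((contDiff_tensorTest hg hη).differentiable (by simp) _), hx, hy]
      simp only [tensorTest, ofReal_mul]
      ring)
    (s := {x ∈ Ioo (-a₀) a₀ | ∀ y ∈ Icc (0 : ℝ) b₀, φ (x, y) = φ (x, 0)}) (fun x hx => hx.1)
    (fun x hx => setIntegral_eq_zero_of_forall_eq_zero fun y hy => by
      simp [hQdef, hA0 x hx y hy])
  filter_upwards [hm0, ae_uniqueDiffWithinAt
    {x ∈ Ioo (-a₀) a₀ | ∀ y ∈ Icc (0 : ℝ) b₀, φ (x, y) = φ (x, 0)}] with x hx hxu hxF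
  rw [← hx hxF]
  refine setIntegral_congr_fun measurableSet_Ioo fun y hy => ?_
  have hAx : pdx (coeffA φ) (x, y) = 0 :=
    (hxu hxF).eq_deriv _ (hasDerivAt_slice_fst (hAd (x, y) ⟨hxF.1, hy⟩)).hasDerivWithinAt
      ((hasDerivWithinAt_const x _ (0 : ℂ)).congr (fun t ht => hA0 t ht y hy) (hA0 x hxF y hy))
  simp only [hPdef, hAx]
  ring

lemma measurableSet_constant_fibers {a₀ b₀ : ℝ} (hb₀ : 0 ≤ b₀) {φ : ℝ × ℝ → ℝ}
    (hφ : ContinuousOn φ (Icc (-a₀) a₀ ×ˢ Icc 0 b₀)) :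
    MeasurableSet {x ∈ Ioo (-a₀) a₀ | ∀ y ∈ Icc (0 : ℝ) b₀, φ (x, y) = φ (x, 0)} := by
  have hslice : ∀ y ∈ Icc (0 : ℝ) b₀, ContinuousOn (fun x => φ (x, y)) (Icc (-a₀) a₀) :=
    fun y hy => hφ.comp (by fun_prop) fun x hx => ⟨hx, hy⟩
  have hcl : ∀ y ∈ Icc (0 : ℝ) b₀,
      IsClosed (Icc (-a₀) a₀ ∩ (fun x => φ (x, y) - φ (x, 0)) ⁻¹' {0}) := fun y hy =>
    ((hslice y hy).sub (hslice 0 ⟨le_rfl, hb₀⟩)).preimage_isClosed_of_isClosed isClosed_Icc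
      isClosed_singleton
  have heq : {x ∈ Ioo (-a₀) a₀ | ∀ y ∈ Icc (0 : ℝ) b₀, φ (x, y) = φ (x, 0)} = Ioo (-a₀) a₀ ∩
      ⋂ y ∈ Icc (0 : ℝ) b₀, Icc (-a₀) a₀ ∩ (fun x => φ (x, y) - φ (x, 0)) ⁻¹' {0} := by
    ext x
    simp only [mem_ofPred_eq, mem_inter_iff, mem_iInter, mem_preimage, mem_singleton_iff,
      sub_eq_zero]
    exact ⟨fun h => ⟨h.1, fun y hy => ⟨Ioo_subset_Icc_self h.1, h.2 y hy⟩⟩,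
      fun h => ⟨h.1, fun y hy => (h.2 y hy).2⟩⟩
  rw [heq]
  exact measurableSet_Ioo.inter (isClosed_biInter hcl).measurableSet

/-- On the set `F` of points `x` where `y ↦ φ(x,y)` is constant, a bounded
solution is essentially constant along almost every vertical fiber. -/
theorem constant_on_fibers
    (a₀ b₀ : ℝ) (ha₀ : 0 < a₀) (hb₀ : 0 < b₀)
    (φ : ℝ × ℝ → ℝ)
    (hφ : ∃ V : Set (ℝ × ℝ), IsOpen V ∧ Icc (-a₀) a₀ ×ˢ Icc 0 b₀ ⊆ V ∧
      ContDiffOn ℝ (⊤ : ℕ∞) φ V)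
    (u : ℝ × ℝ → ℂ) (hu_meas : Measurable u)
    (C : ℝ) (hu_bdd : ∀ p ∈ Ioo (-a₀) a₀ ×ˢ Ioo 0 b₀, ‖u p‖ ≤ C)
    (hsol : IsDistribSol (coeffA φ) u (Ioo (-a₀) a₀ ×ˢ Ioo 0 b₀)) :
    ∃ δ : ℝ, 0 < δ ∧
      ∀ᵐ x ∂(volume.restrict
        ({x ∈ Ioo (-a₀) a₀ | ∀ y ∈ Icc (0 : ℝ) b₀, φ (x, y) = φ (x, 0)} ∩ Ioo (-δ) δ)),
        ∃ c : ℂ, ∀ᵐ y ∂(volume.restrict (Ioo (0 : ℝ) δ)), u (x, y) = c := by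
  obtain ⟨V, hV, hRV, hφV⟩ := hφ
  refine ⟨b₀, hb₀, ae_mono (Measure.restrict_mono inter_subset_left le_rfl) ?_⟩
  refine (ae_restrict_iff' (measurableSet_constant_fibers hb₀.le (hφV.continuousOn.mono hRV))).2 ?_
  obtain ⟨D, hDc, hDt, hD⟩ := exists_countable_isTestOn_du_bois_reymond hb₀
  have hall := (ae_ball_iff hDc).2 fun η hη =>
    ae_integral_mul_deriv_eq_zero ha₀ hV hRV hφV hu_meas hu_bdd hsol (hDt η hη)
  filter_upwards [hall] with x hx hxF
  have hui : IntegrableOn (fun y => u (x, y)) (Ioo 0 b₀) :=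
    Measure.integrableOn_of_bounded (M := C) (by simp)
      (hu_meas.comp measurable_prodMk_left).aestronglyMeasurable
      (ae_restrict_of_forall_mem measurableSet_Ioo fun y hy => hu_bdd (x, y) ⟨hxF.1, hy⟩)
  have hint : ∀ η ∈ D, IntegrableOn (fun y => ((deriv η y : ℝ) : ℂ) * u (x, y)) (Ioo 0 b₀) := by
    intro η hη
    obtain ⟨M, hM⟩ := (hDt η hη).deriv.exists_bound
    exact Integrable.bdd_mul hui
      (continuous_ofReal.comp (hDt η hη).deriv.1.continuous).aestronglyMeasurable
      (Eventually.of_forall fun y => by simpa using hM y)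
  obtain ⟨c₁, hc₁⟩ := hD (fun y => (u (x, y)).re) hui.re fun η hη => by
    have h1 := congrArg re (hx η hη hxF)
    rw [← reCLM_apply, ← reCLM.integral_comp_comm (hint η hη)] at h1
    simpa using h1
  obtain ⟨c₂, hc₂⟩ := hD (fun y => (u (x, y)).im) hui.im fun η hη => by
    have h1 := congrArg im (hx η hη hxF)
    rw [← imCLM_apply, ← imCLM.integral_comp_comm (hint η hη)] at h1
    simpa using h1
  refine ⟨⟨c₁, c₂⟩, (ae_restrict_iff' measurableSet_Ioo).2 ?_⟩
  filter_upwards [hc₁, hc₂] with y h1 h2 hy using Complex.ext (h1 hy) (h2 hy)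
end

section
/- Let α < β, let m, M : (α,β) → ℝ be Lipschitz functions with m(ξ) < M(ξ) for all ξ ∈ (α,β), and let Ω = {ξ + iη ∈ ℂ : α < ξ < β, m(ξ) < η < M(ξ)}. Let U : Ω → ℂ be a bounded holomorphic function. Then for almost every ξ₀ ∈ (α,β), U has a nontangential limit at the lower boundary point ζ₀ = ξ₀ + i·m(ξ₀): for every c > 0 with c·(Lipschitz constant of m) < 1, the limit of U(ζ) as ζ = ξ+iη → ζ₀ within the region {ξ+iη ∈ Ω : |ξ−ξ₀| ≤ c·(η − m(ξ₀))} exists (and is independent of c). In particular, for almost every ξ₀ the vertical limit lim_{t→0⁺} U(ξ₀ + i(m(ξ₀)+t)) exists. -/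
open MeasureTheory Set Filter Topology Complex

theorem re_cpow_half_nonneg (v : ℂ) : 0 ≤ (v ^ ((1 / 2 : ℝ) : ℂ)).re := by
  rcases eq_or_ne v 0 with rfl | hv
  · rw [zero_cpow (by norm_num)]
    simp
  · rw [cpow_def_of_ne_zero hv, exp_re, mul_comm (log v), re_ofReal_mul, im_ofReal_mul, log_im]
    refine mul_nonneg (Real.exp_pos _).le (Real.cos_nonneg_of_mem_Icc ⟨?_, ?_⟩)
    · linarith [neg_pi_lt_arg v]
    · linarith [arg_le_pi v]

/-- The principal square root maps the sector `-K * |im v| ≤ re v` into a proper sector of the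
right half-plane. -/
theorem le_re_cpow_half {K : ℝ} {v : ℂ} (hv : -(K * |v.im|) ≤ v.re) :
    ‖v‖ ^ (1 / 2 : ℝ) / (2 * √(1 + K ^ 2)) ≤ (v ^ ((1 / 2 : ℝ) : ℂ)).re := by
  have hq := re_cpow_half_nonneg v
  have hn : ‖v ^ ((1 / 2 : ℝ) : ℂ)‖ = ‖v‖ ^ (1 / 2 : ℝ) := norm_cpow_real v _
  have hsq : (v ^ ((1 / 2 : ℝ) : ℂ)) ^ 2 = v := by
    rw [← cpow_nat_mul]
    norm_num
  set q := v ^ ((1 / 2 : ℝ) : ℂ)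
  rw [← hn]
  have hn2 : ‖q‖ ^ 2 = ‖v‖ := by rw [← norm_pow, hsq]
  have hre : q.re ^ 2 - q.im ^ 2 = v.re := by
    rw [← hsq, pow_two q, mul_re]
    ring
  have hq2 : ‖q‖ ^ 2 = q.re ^ 2 + q.im ^ 2 := by rw [Complex.sq_norm, normSq_apply]; ring
  have hv2 : ‖v‖ ^ 2 = v.re ^ 2 + v.im ^ 2 := by rw [Complex.sq_norm, normSq_apply]; ring
  have hvn := norm_nonneg v
  have hK : ‖v‖ ≤ 2 * (1 + K ^ 2) * (‖v‖ + v.re) := by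
    rcases le_total 0 v.re with h0 | h0
    · nlinarith [sq_nonneg K, mul_nonneg (sq_nonneg K) (add_nonneg hvn h0)]
    · have h1 : v.re ^ 2 ≤ K ^ 2 * v.im ^ 2 := by
        rw [← sq_abs v.im, ← mul_pow]
        exact sq_le_sq' (by linarith) (by linarith)
      have h2 : ‖v‖ ^ 2 ≤ (1 + K ^ 2) * v.im ^ 2 := by rw [hv2]; nlinarith
      have h3 : v.im ^ 2 = (‖v‖ - v.re) * (‖v‖ + v.re) := by nlinarith
      have h4 : |v.re| ≤ ‖v‖ := abs_re_le_norm v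
      rw [abs_of_nonpos h0] at h4
      rcases hvn.eq_or_lt with h5 | h5
      · rw [← h5] at h4 ⊢
        have : 0 ≤ (1 + K ^ 2) * (0 + v.re) := by
          have : v.re = 0 := by linarith
          simp [this]
        linarith
      · have h6 : ‖v‖ * ‖v‖ ≤ ‖v‖ * (2 * (1 + K ^ 2) * (‖v‖ + v.re)) := by
          calc ‖v‖ * ‖v‖ ≤ (1 + K ^ 2) * ((‖v‖ - v.re) * (‖v‖ + v.re)) := by
                rw [← h3]; linarith
            _ ≤ (1 + K ^ 2) * ((2 * ‖v‖) * (‖v‖ + v.re)) := by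
                gcongr
                · linarith
                · linarith
            _ = _ := by ring
        exact le_of_mul_le_mul_left h6 h5
  have hs : 0 < √(1 + K ^ 2) := Real.sqrt_pos.2 (by positivity)
  rw [div_le_iff₀ (by positivity)]
  refine abs_le_of_sq_le_sq' ?_ (by positivity) |>.2
  rw [mul_pow, mul_pow, Real.sq_sqrt (by positivity)]
  nlinarith

theorem mem_slitPlane_of_sector {K : ℝ} {v : ℂ} (hv : -(K * |v.im|) ≤ v.re) (h0 : v ≠ 0) :
    v ∈ slitPlane := by
  rw [mem_slitPlane_iff]
  by_contra! h
  rw [h.2] at hv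
  exact h0 (Complex.ext (by simpa using le_antisymm h.1 (by simpa using hv)) h.2)

/-- A Phragmén–Lindelöf estimate at a boundary point of the region above a Lipschitz graph. -/
theorem exists_norm_le_of_norm_le_on_graph {m : ℝ → ℝ} {K : NNReal} (hm : LipschitzWith K m)
    {p : ℂ} (hp : p.im = m p.re) {g : ℂ → ℂ} {L δ ε : ℝ} (hc : Continuous g) (hL0 : 0 ≤ L)
    (hL : ∀ z, ‖g z‖ ≤ L * ‖z - p‖) (hδ : 0 < δ) (hε : 0 < ε)
    (hd : DifferentiableOn ℂ g {z | m z.re < z.im ∧ ‖z - p‖ < δ})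
    (hb : ∀ z, z.im = m z.re → ‖z - p‖ < δ → ‖g z‖ ≤ ε * ‖z - p‖) :
    ∃ ρ > 0, ∀ z, m z.re < z.im → ‖z - p‖ < ρ → ‖g z‖ ≤ 3 * ε * ‖z - p‖ := by
  set κ : ℝ := 1 / (2 * √(1 + (K : ℝ) ^ 2)) with hκdef
  have hs : 0 < √(1 + (K : ℝ) ^ 2) := Real.sqrt_pos.2 (by positivity)
  have hκ : 0 < κ := by positivity
  have hδ' : 0 < δ ^ (1 / 2 : ℝ) := Real.rpow_pos_of_pos hδ _
  set A : ℝ := L / (ε * κ * δ ^ (1 / 2 : ℝ)) with hA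
  have hA0 : 0 ≤ A := by positivity
  set v : ℂ → ℂ := fun z => -I * (z - p) with hvdef
  have hvn (z) : ‖v z‖ = ‖z - p‖ := by simp [hvdef]
  have hvd : Differentiable ℂ v := by fun_prop
  have hsec (z : ℂ) (hz : m z.re ≤ z.im) : -(K * |(v z).im|) ≤ (v z).re := by
    have h1 : (v z).re = z.im - p.im := by simp [hvdef]
    have h2 : (v z).im = -(z.re - p.re) := by simp [hvdef]
    have h3 := hm.dist_le_mul z.re p.re
    rw [Real.dist_eq, Real.dist_eq] at h3
    rw [h1, h2, abs_neg]
    linarith [(abs_le.1 h3).1]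
  have hv0 (z : ℂ) (hz : z ≠ p) : v z ≠ 0 := by
    rw [← norm_ne_zero_iff, hvn, norm_ne_zero_iff]
    exact sub_ne_zero.2 hz
  have hslit (z : ℂ) (hz : m z.re ≤ z.im) (h : z ≠ p) : v z ∈ slitPlane :=
    mem_slitPlane_of_sector (hsec z hz) (hv0 z h)
  have hre (z : ℂ) (hz : m z.re ≤ z.im) :
      κ * ‖z - p‖ ^ (1 / 2 : ℝ) ≤ (v z ^ ((1 / 2 : ℝ) : ℂ)).re := by
    have := le_re_cpow_half (hsec z hz)
    rw [hvn] at this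
    rw [hκdef, one_div_mul_eq_div]
    exact this
  set V : Set ℂ := {z | m z.re < z.im ∧ ‖z - p‖ < δ} with hV
  have hVo : IsOpen V :=
    (isOpen_lt (hm.continuous.comp continuous_re) continuous_im).and
      (isOpen_lt (continuous_id.sub continuous_const).norm continuous_const)
  have hVc : closure V ⊆ {z | m z.re ≤ z.im ∧ ‖z - p‖ ≤ δ} := by
    refine closure_minimal (fun z hz => ⟨hz.1.le, hz.2.le⟩) ?_
    exact (isClosed_le (hm.continuous.comp continuous_re) continuous_im).and
      (isClosed_le (continuous_id.sub continuous_const).norm continuous_const)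
  have hVb : Bornology.IsBounded V := by
    refine (Metric.isBounded_ball (x := p) (r := δ)).subset fun z hz => ?_
    rw [Metric.mem_ball, dist_eq_norm]
    exact hz.2
  set h : ℝ → ℂ → ℂ := fun s z =>
    g z * v z ^ ((s - 1 : ℝ) : ℂ) * exp (-A * v z ^ ((1 / 2 : ℝ) : ℂ)) with hh
  have hnorm (s z) : ‖h s z‖ =
      ‖g z‖ * ‖z - p‖ ^ (s - 1) * Real.exp (-(A * (v z ^ ((1 / 2 : ℝ) : ℂ)).re)) := by
    rw [hh]
    simp only [norm_mul, norm_cpow_real, hvn, norm_exp]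
    rw [← ofReal_neg, re_ofReal_mul, neg_mul]
  have hpow (s : ℝ) (z : ℂ) (hz : z ≠ p) : ‖z - p‖ * ‖z - p‖ ^ (s - 1) = ‖z - p‖ ^ s := by
    rw [Real.rpow_sub_one (norm_ne_zero_iff.2 (sub_ne_zero.2 hz)),
      mul_div_cancel₀ _ (norm_ne_zero_iff.2 (sub_ne_zero.2 hz))]
  have hgp : g p = 0 := by simpa using hL p
  have hexp (z) : Real.exp (-(A * (v z ^ ((1 / 2 : ℝ) : ℂ)).re)) ≤ 1 :=
    Real.exp_le_one_iff.2 (by have := mul_nonneg hA0 (re_cpow_half_nonneg (v z)); linarith)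
  have hcoarse {B : ℝ} (s : ℝ) (z : ℂ) (hz : z ≠ p) (hB : ‖g z‖ ≤ B * ‖z - p‖) :
      ‖h s z‖ ≤ B * ‖z - p‖ ^ s * Real.exp (-(A * (v z ^ ((1 / 2 : ℝ) : ℂ)).re)) := by
    rw [hnorm, ← hpow s z hz, ← mul_assoc]
    gcongr
  have hmain (s : ℝ) (hs0 : 0 < s) (z : ℂ) (hz : z ∈ V) : ‖h s z‖ ≤ ε * δ ^ s := by
    refine norm_le_of_forall_mem_frontier_norm_le hVb (f := h s) ⟨?_, ?_⟩ ?_ (subset_closure hz)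
    · intro z hz
      have hzp : z ≠ p := by
        rintro rfl
        exact hz.1.ne' hp
      have hsl := hslit z hz.1.le hzp
      exact ((hd z hz).mul ((hvd z).cpow_const hsl).differentiableWithinAt).mul
        (((hvd z).cpow_const hsl).const_mul _).cexp.differentiableWithinAt
    · intro z hz
      rcases eq_or_ne z p with rfl | hzp
      · have hz0 : h s z = 0 := by simp [hh, hgp]
        refine ContinuousAt.continuousWithinAt ?_
        rw [ContinuousAt, hz0]
        refine squeeze_zero_norm (a := fun w => L * ‖w - z‖ ^ s) (fun w => ?_) ?_
        · rcases eq_or_ne w z with rfl | hw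
          · rw [hz0, norm_zero]
            positivity
          · refine (hcoarse s w hw (hL w)).trans ?_
            exact mul_le_of_le_one_right (by positivity) (hexp w)
        · have : ContinuousAt (fun w => L * ‖w - z‖ ^ s) z :=
            ((continuous_id.sub continuous_const).norm.continuousAt.rpow_const
              (Or.inr hs0.le)).const_mul L
          simpa [ContinuousAt, Real.zero_rpow hs0.ne'] using this
      · have hsl := hslit z (hVc hz).1 hzp
        exact ((hc.continuousAt.mul ((hvd z).cpow_const hsl).continuousAt).mul
          (((hvd z).cpow_const hsl).const_mul _).cexp.continuousAt).continuousWithinAt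
    · intro z hz
      rw [hVo.frontier_eq] at hz
      obtain ⟨h1, h2⟩ := hVc hz.1
      rcases eq_or_ne z p with rfl | hzp
      · simp only [hh, hgp, zero_mul, norm_zero]
        positivity
      rcases h2.lt_or_eq with h3 | h3
      · have h4 : z.im = m z.re := by
          refine le_antisymm (not_lt.1 fun h => hz.2 ⟨h, h3⟩) h1
        refine (hcoarse s z hzp (hb z h4 h3)).trans ?_
        refine (mul_le_of_le_one_right (by positivity) (hexp z)).trans ?_
        gcongr
      · refine (hcoarse s z hzp (hL z)).trans ?_
        have h5 := hre z h1
        rw [h3] at h5 ⊢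
        have h6 : L / ε ≤ A * (v z ^ ((1 / 2 : ℝ) : ℂ)).re := by
          calc L / ε = A * (κ * δ ^ (1 / 2 : ℝ)) := by rw [hA]; field_simp
            _ ≤ _ := by gcongr
        have h7 : L * Real.exp (-(A * (v z ^ ((1 / 2 : ℝ) : ℂ)).re)) ≤ ε := by
          rw [Real.exp_neg, ← div_eq_mul_inv, div_le_iff₀ (Real.exp_pos _)]
          rw [← div_le_iff₀' hε]
          linarith [Real.add_one_le_exp (A * (v z ^ ((1 / 2 : ℝ) : ℂ)).re)]
        calc _ = (L * Real.exp (-(A * (v z ^ ((1 / 2 : ℝ) : ℂ)).re))) * δ ^ s := by ring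
          _ ≤ _ := by gcongr
  refine ⟨min δ (1 / (A + 1) ^ 2), by positivity, fun z hz hzρ => ?_⟩
  obtain ⟨hz1, hz2⟩ := lt_min_iff.1 hzρ
  have hzp : z ≠ p := by
    rintro rfl
    exact hz.ne' hp
  have hpos : 0 < ‖z - p‖ := norm_pos_iff.2 (sub_ne_zero.2 hzp)
  set R := (v z ^ ((1 / 2 : ℝ) : ℂ)).re with hR
  have hlim : ‖g z‖ * ‖z - p‖ ^ (0 - 1 : ℝ) * Real.exp (-(A * R)) ≤ ε * δ ^ (0 : ℝ) := by
    refine le_of_tendsto_of_tendsto (b := 𝓝[>] (0 : ℝ))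
      (f := fun s => ‖g z‖ * ‖z - p‖ ^ (s - 1 : ℝ) * Real.exp (-(A * R)))
      (g := fun s => ε * δ ^ s) ?_ ?_ ?_
    · refine Tendsto.mono_left ?_ nhdsWithin_le_nhds
      refine Continuous.tendsto
        (f := fun s => ‖g z‖ * ‖z - p‖ ^ (s - 1 : ℝ) * Real.exp (-(A * R))) ?_ 0
      exact ((continuous_const.rpow (by fun_prop) fun _ => Or.inl hpos.ne').const_mul _).mul_const _
    · refine Tendsto.mono_left ?_ nhdsWithin_le_nhds
      refine Continuous.tendsto (f := fun s => ε * δ ^ s) ?_ 0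
      exact (continuous_const.rpow continuous_id fun _ => Or.inl hδ.ne').const_mul _
    · filter_upwards [self_mem_nhdsWithin] with s hs0
      rw [← hnorm]
      exact hmain s hs0 z ⟨hz, hz1⟩
  rw [zero_sub, Real.rpow_neg_one, Real.rpow_zero, mul_one, Real.exp_neg, ← div_eq_mul_inv,
    ← div_eq_mul_inv, div_le_iff₀ (Real.exp_pos _), div_le_iff₀ hpos] at hlim
  have hAR : A * R ≤ 1 := by
    have h1 : R ≤ ‖z - p‖ ^ (1 / 2 : ℝ) := by
      have := (le_abs_self _).trans (abs_re_le_norm (v z ^ ((1 / 2 : ℝ) : ℂ)))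
      rwa [norm_cpow_real, hvn] at this
    rw [← Real.sqrt_eq_rpow] at h1
    have h2 : √‖z - p‖ ≤ 1 / (A + 1) := by
      refine Real.sqrt_le_iff.2 ⟨by positivity, ?_⟩
      rw [div_pow, one_pow]
      exact hz2.le
    calc A * R ≤ A * (1 / (A + 1)) := by gcongr; exact h1.trans h2
      _ ≤ 1 := by
        rw [mul_one_div, div_le_one (by positivity)]
        linarith
  have h3 : Real.exp (A * R) ≤ 3 :=
    (Real.exp_le_exp.2 hAR).trans (by linarith [Real.exp_one_lt_d9])
  calc ‖g z‖ ≤ ε * Real.exp (A * R) * ‖z - p‖ := hlim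
    _ ≤ ε * 3 * ‖z - p‖ := by gcongr
    _ = _ := by ring

/-- A holomorphic function that is `o(z - p)` above a Lipschitz graph at a point `p` of the graph
has a derivative tending to zero nontangentially at `p`. -/
theorem tendsto_deriv_zero_of_isLittleO {m : ℝ → ℝ} {K : NNReal} (hm : LipschitzWith K m)
    {p : ℂ} (hp : p.im = m p.re) {g u : ℂ → ℂ} {δ : ℝ} (hδ : 0 < δ)
    (hd : ∀ z, m z.re < z.im → ‖z - p‖ < δ → HasDerivAt g (u z) z)
    (hg : ∀ ε > 0, ∃ ρ > 0, ∀ z, m z.re < z.im → ‖z - p‖ < ρ → ‖g z‖ ≤ ε * ‖z - p‖)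
    {c : ℝ} (hc : 0 < c) (hcK : c * K < 1) :
    Tendsto u (𝓝[{z | |z.re - p.re| ≤ c * (z.im - p.im) ∧ z ≠ p}] p) (𝓝 0) := by
  set κ : ℝ := (1 - c * K) / (2 * (1 + K) * (1 + c)) with hκdef
  have hκ : 0 < κ := div_pos (by linarith) (by positivity)
  have hball (z : ℂ) (hz : |z.re - p.re| ≤ c * (z.im - p.im)) (hzp : z ≠ p) (w : ℂ)
      (hw : ‖w - z‖ ≤ κ * ‖z - p‖) : m w.re < w.im := by
    set t := z.im - p.im with ht
    have ht0 : 0 < t := by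
      have h1 : 0 ≤ t := by
        by_contra! h
        nlinarith [abs_nonneg (z.re - p.re)]
      refine h1.lt_of_ne' fun h => hzp ?_
      rw [h, mul_zero] at hz
      refine Complex.ext ?_ ?_
      · exact sub_eq_zero.1 (abs_nonpos_iff.1 hz)
      · exact sub_eq_zero.1 h
    have h1 : ‖z - p‖ ≤ (1 + c) * t := by
      refine (norm_le_abs_re_add_abs_im _).trans ?_
      rw [sub_re, sub_im, ← ht, abs_of_pos ht0]
      linarith
    have h2 : |w.re - z.re| ≤ ‖w - z‖ := by simpa using abs_re_le_norm (w - z)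
    have h3 : |w.im - z.im| ≤ ‖w - z‖ := by simpa using abs_im_le_norm (w - z)
    have h4 := hm.dist_le_mul w.re z.re
    have h5 := hm.dist_le_mul z.re p.re
    rw [Real.dist_eq, Real.dist_eq] at h4 h5
    have h6 : (1 + K) * ‖w - z‖ < (1 - c * K) * t := by
      calc (1 + K) * ‖w - z‖ ≤ (1 + K) * (κ * ((1 + c) * t)) := by gcongr; exact hw.trans (by gcongr)
        _ = (1 - c * K) * t / 2 := by rw [hκdef]; field_simp
        _ < _ := half_lt_self (mul_pos (by linarith) ht0)
    have h7 : K * |w.re - z.re| ≤ K * ‖w - z‖ := by gcongr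
    have h8 : K * |z.re - p.re| ≤ K * (c * t) := by gcongr
    linarith [(abs_le.1 h3).1, (abs_le.1 h4).2, (abs_le.1 h5).2]
  rw [Metric.tendsto_nhdsWithin_nhds]
  intro ε hε
  obtain ⟨ρ, hρ, hgρ⟩ := hg (ε * κ / (2 * (1 + κ))) (by positivity)
  refine ⟨min δ ρ / (1 + κ), by positivity, fun z hz hzd => ?_⟩
  obtain ⟨hz1, hzp⟩ := hz
  have hpos : 0 < ‖z - p‖ := norm_pos_iff.2 (sub_ne_zero.2 hzp)
  rw [dist_eq_norm, lt_div_iff₀ (by positivity)] at hzd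
  have hw (w : ℂ) (hw : ‖w - z‖ ≤ κ * ‖z - p‖) : ‖w - p‖ ≤ (1 + κ) * ‖z - p‖ := by
    have := norm_add_le (w - z) (z - p)
    rw [sub_add_sub_cancel] at this
    linarith
  have hder (w : ℂ) (h : ‖w - z‖ ≤ κ * ‖z - p‖) : HasDerivAt g (u w) w := by
    refine hd w (hball z hz1 hzp w h) ?_
    linarith [hw w h, min_le_left δ ρ]
  have hdc : DiffContOnCl ℂ g (Metric.ball z (κ * ‖z - p‖)) := by
    refine DifferentiableOn.diffContOnCl fun w h => ?_
    have h' := Metric.closure_ball_subset_closedBall h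
    rw [Metric.mem_closedBall, dist_eq_norm] at h'
    exact (hder w h').differentiableAt.differentiableWithinAt
  have hbd := norm_deriv_le_of_forall_mem_sphere_norm_le (R := κ * ‖z - p‖) (by positivity) hdc
    (C := ε * κ / (2 * (1 + κ)) * ((1 + κ) * ‖z - p‖)) fun w h => by
      rw [mem_sphere_iff_norm] at h
      refine (hgρ w (hball z hz1 hzp w h.le) ?_).trans ?_
      · linarith [hw w h.le, min_le_right δ ρ]
      · gcongr
        exact hw w h.le
  rw [(hder z (by simp; positivity)).deriv] at hbd
  rw [dist_zero_right]
  refine hbd.trans_lt ?_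
  rw [div_lt_iff₀ (by positivity)]
  have : ε * κ / (2 * (1 + κ)) * ((1 + κ) * ‖z - p‖) = ε * (κ * ‖z - p‖) / 2 := by field_simp
  rw [this]
  exact half_lt_self (by positivity)

/-- The part of the strip `|re z - x| < r` between the graph of `m` and the height `T`. -/
def graphStrip (m : ℝ → ℝ) (x r T : ℝ) : Set ℂ :=
  {z | |z.re - x| < r ∧ m z.re < z.im ∧ z.im < T}

theorem isOpen_graphStrip {m : ℝ → ℝ} (hm : Continuous m) (x r T : ℝ) :
    IsOpen (graphStrip m x r T) :=
  (isOpen_lt (continuous_re.sub continuous_const).abs continuous_const).and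
    ((isOpen_lt (hm.comp continuous_re) continuous_im).and
      (isOpen_lt continuous_im continuous_const))

/-- A holomorphic function on a strip above a graph has a primitive. -/
theorem isExactOn_graphStrip {m : ℝ → ℝ} (hm : Continuous m) {x r H T : ℝ} (hr : 0 < r)
    (hHT : H < T) (hmH : ∀ y, |y - x| < r → m y < H) {U : ℂ → ℂ}
    (hU : DifferentiableOn ℂ U (graphStrip m x r T)) : IsExactOn U (graphStrip m x r T) := by
  set D := graphStrip m x r T with hD
  set c : ℂ := ⟨x, H⟩
  have hconv {a b y : ℝ} (ha : |a - x| < r) (hb : |b - x| < r) (hy : y ∈ uIcc a b) :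
      |y - x| < r := by
    have := (convex_ball x r).ordConnected.uIcc_subset (x := a) (y := b)
      (by simpa [Real.dist_eq]) (by simpa [Real.dist_eq]) hy
    simpa [Real.dist_eq] using this
  have hhor (a b : ℝ) (ha : |a - x| < r) (hb : |b - x| < r) (η : ℝ)
      (h : ∀ y ∈ uIcc a b, m y < η) (hη : η < T) :
      IntervalIntegrable (fun y : ℝ => U (y + η * I)) volume a b := by
    refine (hU.continuousOn.comp (by fun_prop) fun y hy => ?_).intervalIntegrable
    simpa [hD, graphStrip] using ⟨hconv ha hb hy, h y hy, hη⟩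
  have hver (a η₁ η₂ : ℝ) (ha : |a - x| < r) (h₁ : m a < η₁) (h₂ : m a < η₂)
      (h₁' : η₁ < T) (h₂' : η₂ < T) :
      IntervalIntegrable (fun y : ℝ => U (a + y * I)) volume η₁ η₂ := by
    refine (hU.continuousOn.comp (by fun_prop) fun y hy => ?_).intervalIntegrable
    rw [uIcc, mem_Icc] at hy
    simpa [hD, graphStrip] using
      ⟨ha, (lt_min h₁ h₂).trans_le hy.1, hy.2.trans_lt (max_lt h₁' h₂')⟩
  refine ⟨fun w => wedgeIntegral c w U, fun z hz => ?_⟩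
  obtain ⟨ρ, hρ, hball⟩ := Metric.isOpen_iff.1 (isOpen_graphStrip hm x r T) z hz
  have hder : HasDerivAt (fun w => wedgeIntegral z w U) (U z) z :=
    (hU.mono hball).isConservativeOn.hasDerivAt_wedgeIntegral (hU.mono hball).continuousOn
      (Metric.mem_ball_self hρ)
  refine (hder.const_add (wedgeIntegral c z U)).congr_of_eventuallyEq ?_
  filter_upwards [Metric.ball_mem_nhds z hρ] with w hw
  have hwD := hball hw
  have hy (y : ℝ) (hy : y ∈ uIcc z.re w.re) : m y < z.im := by
    have : (⟨y, z.im⟩ : ℂ) ∈ Metric.ball z ρ := by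
      rw [Metric.mem_ball, dist_eq_norm] at hw ⊢
      refine lt_of_le_of_lt ?_ hw
      have h1 : (⟨y, z.im⟩ : ℂ) - z = ((y - z.re : ℝ) : ℂ) := by
        apply Complex.ext <;> simp
      rw [h1, norm_real]
      have h2 : |y - z.re| ≤ |w.re - z.re| := abs_sub_left_of_mem_uIcc hy
      exact h2.trans (by simpa using abs_re_le_norm (w - z))
    exact (hball this).2.1
  have hx : |x - x| < r := by simpa
  have e1 := intervalIntegral.integral_add_adjacent_intervals
    (hhor x z.re hx hz.1 H (fun y h => hmH y (hconv hx hz.1 h)) hHT)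
    (hhor z.re w.re hz.1 hwD.1 H (fun y h => hmH y (hconv hz.1 hwD.1 h)) hHT)
  have e2 := intervalIntegral.integral_add_adjacent_intervals
    (hver w.re H z.im hwD.1 (hmH _ hwD.1) (hy _ right_mem_uIcc) hHT hz.2.2)
    (hver w.re z.im w.im hwD.1 (hy _ right_mem_uIcc) hwD.2.1 hz.2.2 hwD.2.2)
  have e3 : (∫ y : ℝ in z.re..w.re, U (y + H * I)) - (∫ y : ℝ in z.re..w.re, U (y + z.im * I)) +
      I • (∫ y : ℝ in H..z.im, U (w.re + y * I)) - I • (∫ y : ℝ in H..z.im, U (z.re + y * I))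
      = 0 := by
    have := integral_boundary_rect_eq_zero_of_differentiableOn U ⟨z.re, H⟩ ⟨w.re, z.im⟩
      (hU.mono fun q hq => ?_)
    · simpa using this
    · rw [mem_reProdIm] at hq
      obtain ⟨h1, h2⟩ := hq
      simp only [uIcc, mem_Icc] at h2
      have h3 := hconv hz.1 hwD.1 h1
      exact ⟨h3, (lt_min (hmH _ h3) (hy _ h1)).trans_le h2.1,
        h2.2.trans_lt (max_lt hHT hz.2.2)⟩
  simp only [wedgeIntegral, c, smul_eq_mul] at e3 ⊢
  rw [← e1, ← e2]
  linear_combination e3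

/-- A function with bounded derivative on a strip above a Lipschitz graph is Lipschitz on every
sufficiently lower strip. -/
theorem norm_sub_le_of_graphStrip {m : ℝ → ℝ} {K : NNReal} (hm : LipschitzWith K m)
    {x r H T C : ℝ} (hHT : H < T) (hr : 2 * K * r ≤ T - H)
    {F U : ℂ → ℂ} (hF : ∀ z ∈ graphStrip m x r T, HasDerivAt F (U z) z)
    (hU : ∀ z ∈ graphStrip m x r T, ‖U z‖ ≤ C) {z w : ℂ} (hz : z ∈ graphStrip m x r H)
    (hw : w ∈ graphStrip m x r H) : ‖F w - F z‖ ≤ C * (1 + 2 * K) * ‖w - z‖ := by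
  have hC : 0 ≤ C := (norm_nonneg _).trans (hU z ⟨hz.1, hz.2.1, hz.2.2.trans hHT⟩)
  have hseg (a b : ℂ) (h : segment ℝ a b ⊆ graphStrip m x r T) :
      ‖F b - F a‖ ≤ C * ‖b - a‖ :=
    (convex_segment a b).norm_image_sub_le_of_norm_hasDerivWithin_le
      (fun q hq => (hF q (h hq)).hasDerivWithinAt) (fun q hq => hU q (h hq))
      (left_mem_segment ℝ a b) (right_mem_segment ℝ a b)
  set d := |w.re - z.re| with hd
  have hd0 : 0 ≤ d := abs_nonneg _
  have hdn : d ≤ ‖w - z‖ := by simpa using abs_re_le_norm (w - z)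
  have hdr : K * d ≤ T - H := by
    have : d ≤ 2 * r := by
      have := abs_sub_le w.re x z.re
      rw [abs_sub_comm x] at this
      linarith [hz.1, hw.1]
    calc K * d ≤ K * (2 * r) := by gcongr
      _ ≤ _ := by linarith
  have hKd : 0 ≤ K * d := by positivity
  have hup (a : ℂ) (ha : a ∈ graphStrip m x r H) :
      ‖F (a + (K * d : ℝ) * I) - F a‖ ≤ C * (K * d) := by
    refine (hseg a (a + (K * d : ℝ) * I) fun q hq => ?_).trans_eq ?_
    · rw [segment_eq_image'] at hq
      obtain ⟨θ, hθ, rfl⟩ := hq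
      have h1 : θ * (K * d) ≤ K * d := mul_le_of_le_one_left hKd hθ.2
      have h2 : 0 ≤ θ * (K * d) := mul_nonneg hθ.1 hKd
      obtain ⟨a1, a2, a3⟩ := ha
      simp only [graphStrip, mem_ofPred_eq, add_re, real_smul, re_ofReal_mul, add_im,
        im_ofReal_mul, add_sub_cancel_left, I_re, I_im, mul_zero, mul_one, add_zero]
      exact ⟨a1, by linarith, by linarith⟩
    · rw [add_sub_cancel_left, norm_mul, norm_I, mul_one, norm_real, Real.norm_of_nonneg hKd]
  have hmid : ‖F (w + (K * d : ℝ) * I) - F (z + (K * d : ℝ) * I)‖ ≤ C * ‖w - z‖ := by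
    refine (hseg _ _ fun q hq => ?_).trans_eq (by rw [add_sub_add_right_eq_sub])
    rw [segment_eq_image'] at hq
    obtain ⟨θ, hθ, rfl⟩ := hq
    obtain ⟨z1, z2, z3⟩ := hz
    obtain ⟨w1, w2, w3⟩ := hw
    simp only [graphStrip, mem_ofPred_eq, add_re, real_smul, re_ofReal_mul, add_im,
        im_ofReal_mul, add_sub_add_right_eq_sub, I_re, I_im, mul_zero, mul_one, add_zero,
        sub_re, sub_im]
    have hθ' : 0 ≤ 1 - θ := by linarith [hθ.2]
    have e1 := hm.dist_le_mul (z.re + θ * (w.re - z.re)) z.re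
    have e2 := hm.dist_le_mul (z.re + θ * (w.re - z.re)) w.re
    have e3 : z.re + θ * (w.re - z.re) - w.re = -((1 - θ) * (w.re - z.re)) := by ring
    rw [Real.dist_eq, Real.dist_eq] at e1 e2
    rw [add_sub_cancel_left, abs_mul, abs_of_nonneg hθ.1, ← hd] at e1
    rw [e3, abs_neg, abs_mul, abs_of_nonneg hθ', ← hd] at e2
    have e4 : K * (θ * d) ≤ K * d := by
      gcongr
      exact mul_le_of_le_one_left hd0 hθ.2
    have e5 : K * ((1 - θ) * d) ≤ K * d := by
      gcongr
      exact mul_le_of_le_one_left hd0 (by linarith [hθ.1])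
    have f1 := (abs_le.1 e1).2
    have f2 := (abs_le.1 e2).2
    refine ⟨?_, ?_, ?_⟩
    · have : z.re + θ * (w.re - z.re) - x = (1 - θ) * (z.re - x) + θ * (w.re - x) := by ring
      rw [abs_lt] at z1 w1 ⊢
      rw [this]
      rcases hθ.1.eq_or_lt with h | h
      · subst h; constructor <;> linarith
      · constructor <;> nlinarith
    · rcases le_total z.im w.im with h | h
      · nlinarith [mul_nonneg hθ.1 (sub_nonneg.2 h)]
      · nlinarith [mul_nonneg hθ' (sub_nonneg.2 h)]
    · rcases le_total z.im w.im with h | h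
      · nlinarith [mul_nonneg hθ' (sub_nonneg.2 h)]
      · nlinarith [mul_nonneg hθ.1 (sub_nonneg.2 h)]
  have h1 := hup z hz
  have h2 := hup w hw
  have key : F w - F z = (F (w + (K * d : ℝ) * I) - F (z + (K * d : ℝ) * I)) -
      (F (w + (K * d : ℝ) * I) - F w) + (F (z + (K * d : ℝ) * I) - F z) := by ring
  have h3 : C * (K * d) ≤ C * (K * ‖w - z‖) := by gcongr
  rw [key]
  refine (norm_add_le _ _).trans ((add_le_add_left (norm_sub_le _ _) _).trans ?_)
  linarith

/-- A bounded holomorphic function on a strip above a Lipschitz graph has nontangential limits at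
almost every point of the graph: its primitive extends to a Lipschitz function on the closure, and
the limits exist wherever both the graph and the boundary values of the primitive are
differentiable. -/
theorem ae_exists_tendsto_of_graphStrip {m : ℝ → ℝ} {K : NNReal} (hm : LipschitzWith K m)
    {x r H T C : ℝ} (hr0 : 0 < r) (hHT : H < T) (hr : 2 * K * r ≤ T - H)
    (hmH : ∀ y, |y - x| < r → m y < H) {U : ℂ → ℂ}
    (hU : DifferentiableOn ℂ U (graphStrip m x r T))
    (hUb : ∀ z ∈ graphStrip m x r T, ‖U z‖ ≤ C) :
    ∀ᵐ ξ : ℝ, |ξ - x| < r → ∃ l : ℂ, ∀ c : ℝ, 0 < c → c * K < 1 →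
      Tendsto U (𝓝[{z : ℂ | |z.re - ξ| ≤ c * (z.im - m ξ) ∧ z ≠ ξ + m ξ * I}] (ξ + m ξ * I))
        (𝓝 l) := by
  obtain ⟨F, hF⟩ := isExactOn_graphStrip hm.continuous hr0 hHT hmH hU
  have hlip : LipschitzOnWith (C * (1 + 2 * K)).toNNReal F (graphStrip m x r H) :=
    LipschitzOnWith.of_dist_le_mul fun w hw z hz => by
      rw [dist_eq_norm, dist_eq_norm]
      refine (norm_sub_le_of_graphStrip hm hHT hr hF hUb hz hw).trans ?_
      gcongr
      exact Real.le_coe_toNNReal _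
  obtain ⟨G, hG, hFG⟩ := hlip.extend_finite_dimension
  have hGU (z : ℂ) (hz : z ∈ graphStrip m x r H) : HasDerivAt G (U z) z := by
    refine (hF z ⟨hz.1, hz.2.1, hz.2.2.trans hHT⟩).congr_of_eventuallyEq ?_
    filter_upwards [(isOpen_graphStrip hm.continuous x r H).mem_nhds hz] with w hw
    exact (hFG hw).symm
  have hgraph : LipschitzWith (1 + K) fun y : ℝ => (y + m y * I : ℂ) := by
    refine LipschitzWith.of_dist_le_mul fun a b => ?_
    have h1 := hm.dist_le_mul a b
    rw [Real.dist_eq, Real.dist_eq] at h1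
    rw [dist_eq_norm, Real.dist_eq]
    refine (norm_le_abs_re_add_abs_im _).trans ?_
    simp
    linarith
  filter_upwards [(hG.comp hgraph).ae_differentiableAt, hm.ae_differentiableAt] with ξ hfd hmd hξ
  set p : ℂ := ξ + m ξ * I with hp
  have hpre : p.re = ξ := by simp [hp]
  have hpim : p.im = m ξ := by simp [hp]
  have hcurve : HasDerivAt (fun y : ℝ => (y + m y * I : ℂ)) (1 + deriv m ξ * I) ξ :=
    (hasDerivAt_id ξ).ofReal_comp.add (hmd.hasDerivAt.ofReal_comp.mul_const I)
  have hne : (1 + deriv m ξ * I : ℂ) ≠ 0 := fun h => by simpa using congrArg re h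
  set a : ℂ := deriv (G ∘ fun y : ℝ => (y + m y * I : ℂ)) ξ / (1 + deriv m ξ * I) with ha
  refine ⟨a, fun c hc hcK => ?_⟩
  set g : ℂ → ℂ := fun z => G z - G p - a * (z - p) with hg
  have hgc : Continuous g := by
    have := hG.continuous
    fun_prop
  obtain ⟨δ, hδ, hδD⟩ : ∃ δ > 0, ∀ z, m z.re < z.im → ‖z - p‖ < δ → z ∈ graphStrip m x r H := by
    have hopen : IsOpen {z : ℂ | |z.re - x| < r ∧ z.im < H} :=
      (isOpen_lt (continuous_re.sub continuous_const).abs continuous_const).and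
        (isOpen_lt continuous_im continuous_const)
    obtain ⟨δ, hδ, hb⟩ := Metric.isOpen_iff.1 hopen p
      ⟨by rwa [hpre], by rw [hpim]; exact hmH ξ hξ⟩
    refine ⟨δ, hδ, fun z hz hzp => ?_⟩
    have := hb (show z ∈ Metric.ball p δ by rwa [Metric.mem_ball, dist_eq_norm])
    exact ⟨this.1, hz, this.2⟩
  have hder (z : ℂ) (hz : m z.re < z.im) (hzp : ‖z - p‖ < δ) : HasDerivAt g (U z - a) z := by
    have := ((hGU z (hδD z hz hzp)).sub_const (G p)).sub
      (((hasDerivAt_id z).sub_const p).const_mul a)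
    rw [mul_one] at this
    exact this
  have hcomp : HasDerivAt (fun y : ℝ => g (y + m y * I)) 0 ξ := by
    have := (hfd.hasDerivAt.sub_const (G p)).sub ((hcurve.sub_const p).const_mul a)
    rw [ha, div_mul_cancel₀ _ hne, sub_self] at this
    exact this
  have hlo (ε : ℝ) (hε : 0 < ε) :
      ∃ ρ > 0, ∀ z, m z.re < z.im → ‖z - p‖ < ρ → ‖g z‖ ≤ ε * ‖z - p‖ := by
    have h1 := (hasDerivAt_iff_isLittleO.1 hcomp).def (show 0 < ε / 3 by positivity)
    obtain ⟨η, hη, h2⟩ := Metric.eventually_nhds_iff.1 h1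
    set L : ℝ := lipschitzExtensionConstant ℂ * (C * (1 + 2 * K)).toNNReal + ‖a‖ with hL
    have hgL (z : ℂ) : ‖g z‖ ≤ L * ‖z - p‖ := by
      have := hG.dist_le_mul z p
      rw [dist_eq_norm, dist_eq_norm] at this
      refine (norm_sub_le _ _).trans ?_
      rw [norm_mul, hL, add_mul]
      gcongr
      exact this
    have hgd : DifferentiableOn ℂ g {z | m z.re < z.im ∧ ‖z - p‖ < min δ η} := fun z hz =>
      (hder z hz.1 (hz.2.trans_le (min_le_left _ _))).differentiableAt.differentiableWithinAt
    have hgb (z : ℂ) (hz : z.im = m z.re) (hzp : ‖z - p‖ < min δ η) :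
        ‖g z‖ ≤ ε / 3 * ‖z - p‖ := by
      have h4 : |z.re - ξ| ≤ ‖z - p‖ := by
        have := abs_re_le_norm (z - p)
        rwa [sub_re, hpre] at this
      have h5 := h2 (y := z.re) (by
        rw [Real.dist_eq]
        exact h4.trans_lt (hzp.trans_le (min_le_right _ _)))
      have h6 : (z.re + m z.re * I : ℂ) = z := by rw [← hz, re_add_im]
      have h7 : g p = 0 := by simp [hg]
      rw [h6, ← hp, h7, smul_zero, sub_zero, sub_zero] at h5
      refine h5.trans ?_
      gcongr
      exact h4
    obtain ⟨ρ, hρ, h3⟩ := exists_norm_le_of_norm_le_on_graph hm (by rw [hpre, hpim]) hgc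
      (by positivity) hgL (by positivity) (by positivity) hgd hgb
    exact ⟨ρ, hρ, fun z hz hzp => (h3 z hz hzp).trans_eq (by ring)⟩
  have := tendsto_deriv_zero_of_isLittleO hm (p := p) (by rw [hpre, hpim]) hδ hder hlo hc hcK
  rw [hpre, hpim] at this
  simpa using this.add_const a

/-- Fatou's theorem on a domain bounded by Lipschitz graphs: a bounded holomorphic
function has nontangential limits at almost every point of the lower boundary
graph; in particular vertical limits exist almost everywhere. -/
theorem nontangential_limits_on_lipschitz_domain
    (α β : ℝ) (hαβ : α < β)
    (m M : ℝ → ℝ)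
    (Km KM : NNReal)
    (hm : LipschitzOnWith Km m (Ioo α β))
    (hM : LipschitzOnWith KM M (Ioo α β))
    (hmM : ∀ ξ ∈ Ioo α β, m ξ < M ξ)
    (U : ℂ → ℂ)
    (hU : DifferentiableOn ℂ U
      {ζ : ℂ | ζ.re ∈ Ioo α β ∧ ζ.im ∈ Ioo (m ζ.re) (M ζ.re)})
    (C : ℝ) (hUb : ∀ ζ ∈ {ζ : ℂ | ζ.re ∈ Ioo α β ∧ ζ.im ∈ Ioo (m ζ.re) (M ζ.re)},
      ‖U ζ‖ ≤ C) :
    ∀ᵐ ξ₀ ∂(volume.restrict (Ioo α β)), ∃ l : ℂ,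
      (∀ c : ℝ, 0 < c → c * (Km : ℝ) < 1 →
        Tendsto U
          (𝓝[{ζ : ℂ | (ζ.re ∈ Ioo α β ∧ ζ.im ∈ Ioo (m ζ.re) (M ζ.re)) ∧
              |ζ.re - ξ₀| ≤ c * (ζ.im - m ξ₀)}]
            (ξ₀ + (m ξ₀) * Complex.I))
          (𝓝 l)) ∧
      Tendsto (fun t : ℝ => U (ξ₀ + (m ξ₀ + t) * Complex.I)) (𝓝[>] (0:ℝ)) (𝓝 l) := by
  obtain ⟨m', hm', hmm'⟩ := hm.extend_real
  suffices hloc : ∀ x ∈ Ioo α β, ∃ r > 0, Metric.ball x r ⊆ Ioo α β ∧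
      ∀ᵐ ξ : ℝ, |ξ - x| < r → ∃ l : ℂ, ∀ c : ℝ, 0 < c → c * Km < 1 →
        Tendsto U (𝓝[{z : ℂ | |z.re - ξ| ≤ c * (z.im - m' ξ) ∧ z ≠ ξ + m' ξ * I}]
          (ξ + m' ξ * I)) (𝓝 l) by
    have hae : ∀ᵐ ξ : ℝ, ξ ∈ Ioo α β → ∃ l : ℂ, ∀ c : ℝ, 0 < c → c * Km < 1 →
        Tendsto U (𝓝[{z : ℂ | |z.re - ξ| ≤ c * (z.im - m' ξ) ∧ z ≠ ξ + m' ξ * I}]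
          (ξ + m' ξ * I)) (𝓝 l) := by
      rw [ae_iff]
      refine measure_null_of_locally_null _ fun x hx => ?_
      simp only [mem_ofPred_eq, Classical.not_imp] at hx
      obtain ⟨r, hr, -, h⟩ := hloc x hx.1
      refine ⟨_, inter_mem_nhdsWithin _ (Metric.ball_mem_nhds x hr), measure_mono_null ?_ h⟩
      intro ξ hξ h'
      obtain ⟨h1, h2⟩ := hξ
      exact h1 fun _ => h' (by simpa [Real.dist_eq] using h2)
    rw [ae_restrict_iff' measurableSet_Ioo]
    filter_upwards [hae] with ξ h hξ
    obtain ⟨l, hl⟩ := h hξ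
    rw [← hmm' hξ] at hl
    refine ⟨l, fun c hc hcK => (hl c hc hcK).mono_left (nhdsWithin_mono _ ?_), ?_⟩
    · rintro z ⟨⟨-, hz⟩, hz'⟩
      refine ⟨hz', ?_⟩
      rintro rfl
      simp at hz
    · have hK : (0 : ℝ) < 1 + Km := by positivity
      refine (hl (1 / (1 + Km)) (by positivity) ?_).comp (tendsto_nhdsWithin_iff.2 ⟨?_, ?_⟩)
      · rw [one_div_mul_eq_div, div_lt_one hK]
        linarith
      · refine Tendsto.mono_left ?_ nhdsWithin_le_nhds
        have : Continuous fun t : ℝ => (ξ + (m ξ + t) * I : ℂ) := by fun_prop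
        simpa using this.tendsto 0
      · filter_upwards [self_mem_nhdsWithin] with t ht
        have ht' : (0 : ℝ) < t := ht
        refine ⟨?_, fun h => ht'.ne' ?_⟩
        · simp
          positivity
        · simpa using congrArg im h
  intro x hx
  set d := M x - m' x with hd
  have hd0 : 0 < d := by rw [hd, ← hmm' hx]; linarith [hmM x hx]
  have hMc : ∀ᶠ y in 𝓝 x, m' x + 3 * d / 4 < M y :=
    (hM.continuousOn.continuousAt (Ioo_mem_nhds hx.1 hx.2)).eventually_const_lt (by linarith)
  obtain ⟨r₁, hr₁, hball⟩ := Metric.eventually_nhds_iff.1 (hMc.and (Ioo_mem_nhds hx.1 hx.2))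
  have hK : (0 : ℝ) < 8 * (1 + Km) := by positivity
  set r := min r₁ (d / (8 * (1 + Km))) with hr
  have hr0 : 0 < r := by positivity
  have hKr : 8 * (1 + Km) * r ≤ d := by
    rw [← le_div_iff₀' hK]
    exact min_le_right _ _
  have hb (y : ℝ) (hy : |y - x| < r) : m' x + 3 * d / 4 < M y ∧ y ∈ Ioo α β :=
    hball (by rw [Real.dist_eq]; exact hy.trans_le (min_le_left _ _))
  have hsub : graphStrip m' x r (m' x + 3 * d / 4) ⊆
      {ζ : ℂ | ζ.re ∈ Ioo α β ∧ ζ.im ∈ Ioo (m ζ.re) (M ζ.re)} := by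
    rintro z ⟨h1, h2, h3⟩
    obtain ⟨h4, h5⟩ := hb _ h1
    refine ⟨h5, ?_, h3.trans h4⟩
    rwa [hmm' h5]
  refine ⟨r, hr0, fun y hy => (hb y (by simpa [Real.dist_eq] using hy)).2, ?_⟩
  refine ae_exists_tendsto_of_graphStrip (H := m' x + d / 2) (T := m' x + 3 * d / 4) hm' hr0
    (by linarith) (by linarith) (fun y hy => ?_) (hU.mono hsub) fun z hz => hUb z (hsub hz)
  have h1 := hm'.dist_le_mul y x
  rw [Real.dist_eq, Real.dist_eq] at h1
  have h2 : Km * |y - x| ≤ Km * r := by gcongr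
  linarith [(abs_le.1 h1).2]
end
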